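/- For all n ≥ 1 and m ≥ 1, the map D(n,m) → T(n,m), sending a tuple (p_0,…,p_m) to the class of the tuple of real root divisors of the p_i (each real root taken with its multiplicity, and multiplicities then reduced mod 2), is continuous and is a homotopy equivalence. -/

import Mathlib

noncomputable section

/-- Evaluation at `x` of the monic polynomial `x^n + ∑_{j<n} c_j x^j` determined by the
coefficient vector `c`. -/
def evalMonic (n : ℕ) (c : Fin n → ℝ) (x : ℝ) : ℝ :=
  x ^ n + ∑ j : Fin n, c j * x ^ (j : ℕ)

/-- `D(n,m)`: the space of `(m+1)`-tuples of monic real polynomials of degree `n`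
(recorded by their lower-order coefficient vectors, i.e. as a subspace of `ℝ^{n(m+1)}`)
having no common real root. -/
def Dspace (n m : ℕ) : Set (Fin (m + 1) → Fin n → ℝ) :=
  {c | ∀ x : ℝ, ∃ i, evalMonic n (c i) x ≠ 0}

open scoped Classical

/-- `Sym^n ℝ`, the `n`-fold symmetric product of `ℝ` with the quotient topology:
the quotient of `ℝ^n` identifying tuples with the same underlying multiset.
Its points are effective divisors of degree `n` on `ℝ`. -/
def SymDiv (n : ℕ) :=
  Quotient (Setoid.ker (fun u : Fin n → ℝ => (↑(List.ofFn u) : Multiset ℝ)))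

instance (n : ℕ) : TopologicalSpace (SymDiv n) :=
  inferInstanceAs (TopologicalSpace (Quotient _))

/-- The multiplicity of the point `x` in the degree-`n` divisor `ζ`. -/
noncomputable def multOf {n : ℕ} (ζ : SymDiv n) (x : ℝ) : ℕ :=
  Quotient.liftOn ζ (fun u => Multiset.count x (↑(List.ofFn u) : Multiset ℝ))
    (fun _ _ h => congrArg (Multiset.count x) h)

/-- `S(n,m)`: tuples of `m+1` effective degree-`n` divisors on `ℝ` such that no point of
`ℝ` lies in the support of all of them. -/
def Sspace (n m : ℕ) : Set (Fin (m + 1) → SymDiv n) :=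
  {ζ | ∀ x : ℝ, ∃ i, multOf (ζ i) x = 0}

/-- The equivalence relation on `S(n,m)` identifying two tuples of divisors whenever,
at every point of `ℝ`, the multiplicities in corresponding divisors agree mod `2`. -/
def Tsetoid (n m : ℕ) : Setoid ↥(Sspace n m) :=
  Setoid.ker (fun ζ => fun (i : Fin (m + 1)) (x : ℝ) => multOf (ζ.1 i) x % 2)

/-- `T(n,m)`: the space of mod-2 particle configurations, i.e. the quotient of `S(n,m)`
by mod-2 equality of multiplicities, with the quotient topology. -/
def Tspace (n m : ℕ) := Quotient (Tsetoid n m)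

instance (n m : ℕ) : TopologicalSpace (Tspace n m) :=
  inferInstanceAs (TopologicalSpace (Quotient _))

/-- The monic polynomial `x^n + ∑_{j<n} c_j x^j` determined by the coefficient
vector `c`. -/
def polyOf (n : ℕ) (c : Fin n → ℝ) : Polynomial ℝ :=
  Polynomial.X ^ n + ∑ j : Fin n, Polynomial.C (c j) * Polynomial.X ^ (j : ℕ)

section

open Set Filter Topology

/-- Two tuples of reals are parity equivalent when every point occurs in them with the same
multiplicity modulo `2`, expressed through products of signs. -/
def ParityEquiv {n : ℕ} (u w : Fin n → ℝ) : Prop :=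
  ∀ g : ℝ → ℤˣ, ∏ j, g (u j) = ∏ j, g (w j)

/-- The number of occurrences of `x` in the tuple `u`. -/
def occ {n : ℕ} {α : Type*} (u : Fin n → α) (x : α) : ℕ :=
  (Finset.univ.filter fun j => u j = x).card

theorem prod_sign_eq_neg_one_pow_occ {n : ℕ} {α : Type*} (u : Fin n → α) (x : α) :
    ∏ j, (if u j = x then (-1 : ℤˣ) else 1) = (-1) ^ occ u x := by
  rw [Finset.prod_ite]
  simp [occ]

theorem units_pow_eq_of_mod_two (a : ℤˣ) {k l : ℕ} (h : k % 2 = l % 2) : a ^ k = a ^ l := by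
  rw [Int.units_pow_eq_pow_mod_two a k, h, ← Int.units_pow_eq_pow_mod_two]

theorem mod_two_eq_of_neg_one_pow_eq {k l : ℕ} (h : (-1 : ℤˣ) ^ k = (-1) ^ l) :
    k % 2 = l % 2 := by
  rcases Nat.even_or_odd k with hk | hk <;> rcases Nat.even_or_odd l with hl | hl <;>
    simp only [hk.neg_one_pow, hl.neg_one_pow] at h
  · rw [Nat.even_iff.1 hk, Nat.even_iff.1 hl]
  · exact absurd h (by decide)
  · exact absurd h (by decide)
  · rw [Nat.odd_iff.1 hk, Nat.odd_iff.1 hl]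

theorem prod_eq_prod_pow_occ {n : ℕ} {α : Type*} (u : Fin n → α) (g : α → ℤˣ) (s : Finset α)
    (hs : ∀ j, u j ∈ s) : ∏ j, g (u j) = ∏ b ∈ s, g b ^ occ u b := by
  rw [Finset.prod_comp]
  refine Finset.prod_subset (fun b hb => ?_) (fun b _ hb => ?_)
  · obtain ⟨j, -, rfl⟩ := Finset.mem_image.1 hb
    exact hs j
  · have : ∀ j, u j ≠ b := fun j hj => hb (Finset.mem_image.2 ⟨j, Finset.mem_univ _, hj⟩)
    simp [this]

theorem parityEquiv_iff {n : ℕ} (u w : Fin n → ℝ) :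
    ParityEquiv u w ↔ ∀ x, occ u x % 2 = occ w x % 2 := by
  refine ⟨fun h x => mod_two_eq_of_neg_one_pow_eq ?_, fun h g => ?_⟩
  · rw [← prod_sign_eq_neg_one_pow_occ, ← prod_sign_eq_neg_one_pow_occ]
    exact h fun y => if y = x then -1 else 1
  · have hu : ∀ j, u j ∈ Finset.univ.image u ∪ Finset.univ.image w := by simp
    have hw : ∀ j, w j ∈ Finset.univ.image u ∪ Finset.univ.image w := by simp
    rw [prod_eq_prod_pow_occ u g _ hu, prod_eq_prod_pow_occ w g _ hw]
    exact Finset.prod_congr rfl fun b _ => units_pow_eq_of_mod_two _ (h b)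

theorem ParityEquiv.symm {n : ℕ} {u w : Fin n → ℝ} (h : ParityEquiv u w) : ParityEquiv w u :=
  fun g => (h g).symm

theorem ParityEquiv.trans {n : ℕ} {u v w : Fin n → ℝ} (h : ParityEquiv u v)
    (h' : ParityEquiv v w) : ParityEquiv u w :=
  fun g => (h g).trans (h' g)

/-- The sign of `∏ j, (y - u j)` immediately to the right of `y`. -/
def rightSign {n : ℕ} (u : Fin n → ℝ) (y : ℝ) : ℤˣ :=
  ∏ j, if y < u j then -1 else 1

theorem ParityEquiv.rightSign_eq {n : ℕ} {u w : Fin n → ℝ} (h : ParityEquiv u w) (y : ℝ) :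
    rightSign u y = rightSign w y :=
  h fun z => if y < z then -1 else 1

theorem rightSign_mul_rightSign {n : ℕ} (u : Fin n → ℝ) {y z : ℝ} (hyz : y ≤ z) :
    rightSign u y * rightSign u z = ∏ j, if y < u j ∧ u j ≤ z then (-1 : ℤˣ) else 1 := by
  rw [rightSign, rightSign, ← Finset.prod_mul_distrib]
  refine Finset.prod_congr rfl fun j _ => ?_
  by_cases h1 : y < u j <;> by_cases h2 : z < u j
  · simp [h1, h2]
  · simp [h1, h2, not_lt.1 h2]
  · exact absurd (hyz.trans_lt h2) h1
  · simp [h1, h2]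

/-- The symmetric product projection `ℝ^n → Sym^n ℝ`. -/
def symMk {n : ℕ} (u : Fin n → ℝ) : SymDiv n :=
  Quotient.mk _ u

theorem multOf_symMk {n : ℕ} (u : Fin n → ℝ) (x : ℝ) : multOf (symMk u) x = occ u x := by
  change Multiset.count x (↑(List.ofFn u) : Multiset ℝ) = occ u x
  have : (↑(List.ofFn u) : Multiset ℝ) = Multiset.map u (Finset.univ : Finset (Fin n)).val := by
    rw [Fin.univ_val_map]
  rw [this, Multiset.count_map]
  simp only [occ, Finset.card, Finset.filter_val, eq_comm]

theorem exists_perm_of_symMk_eq {n : ℕ} {u v : Fin n → ℝ} (h : symMk u = symMk v) :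
    ∃ σ : Equiv.Perm (Fin n), u ∘ σ = v := by
  have h1 : (↑(List.ofFn u) : Multiset ℝ) = ↑(List.ofFn v) := Quotient.exact h
  have h2 : (List.ofFn u).Perm (List.ofFn v) := Multiset.coe_eq_coe.1 h1
  have h3 : List.ofFn (u ∘ Tuple.sort u) = List.ofFn (v ∘ Tuple.sort v) :=
    ((((Tuple.sort u).ofFn_comp_perm u).trans h2).trans
      ((Tuple.sort v).ofFn_comp_perm v).symm).eq_of_pairwise'
      (Tuple.monotone_sort u).sortedLE_ofFn.pairwise (Tuple.monotone_sort v).sortedLE_ofFn.pairwise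
  have h4 := List.ofFn_injective h3
  refine ⟨(Tuple.sort v).symm.trans (Tuple.sort u), ?_⟩
  funext j
  have := congrFun h4 ((Tuple.sort v).symm j)
  simpa using this

theorem symMk_comp_perm {n : ℕ} (u : Fin n → ℝ) (σ : Equiv.Perm (Fin n)) :
    symMk (u ∘ σ) = symMk u :=
  Quotient.sound (Multiset.coe_eq_coe.2 (σ.ofFn_comp_perm u) :)

theorem isOpenQuotientMap_symMk (n : ℕ) : IsOpenQuotientMap (symMk : (Fin n → ℝ) → SymDiv n) := by
  have hq : IsQuotientMap (symMk : (Fin n → ℝ) → SymDiv n) := isQuotientMap_quotient_mk'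
  refine ⟨hq.surjective, hq.continuous, fun U hU => hq.isOpen_preimage.1 ?_⟩
  have : symMk ⁻¹' (symMk '' U) =
      ⋃ σ : Equiv.Perm (Fin n), (fun u : Fin n → ℝ => u ∘ σ) ⁻¹' U := by
    ext v
    simp only [mem_preimage, mem_image, mem_iUnion]
    constructor
    · rintro ⟨u, hu, h⟩
      obtain ⟨σ, hσ⟩ := exists_perm_of_symMk_eq h.symm
      exact ⟨σ, hσ ▸ hu⟩
    · rintro ⟨σ, h⟩
      exact ⟨_, h, symMk_comp_perm v σ⟩
  rw [this]
  exact isOpen_iUnion fun σ => hU.preimage (by fun_prop)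

/-- Ordered configurations: tuples of points of `ℝ` representing a point of `S(n,m)`. -/
def OrdConf (n m : ℕ) : Set (Fin (m + 1) → Fin n → ℝ) :=
  {u | ∀ x : ℝ, ∃ i, ∀ j, u i j ≠ x}

theorem occ_eq_zero_iff {n : ℕ} {u : Fin n → ℝ} {x : ℝ} : occ u x = 0 ↔ ∀ j, u j ≠ x := by
  simp [occ, Finset.filter_eq_empty_iff]

theorem symMk_mem_Sspace_iff {n m : ℕ} (u : Fin (m + 1) → Fin n → ℝ) :
    (fun i => symMk (u i)) ∈ Sspace n m ↔ u ∈ OrdConf n m := by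
  simp only [Sspace, OrdConf, mem_ofPred_eq, multOf_symMk, occ_eq_zero_iff]

/-- The point of `S(n,m)` represented by an ordered configuration. -/
def toS {n m : ℕ} (u : OrdConf n m) : Sspace n m :=
  ⟨fun i => symMk (u.1 i), (symMk_mem_Sspace_iff u.1).2 u.2⟩

/-- The point of `T(n,m)` represented by an ordered configuration. -/
def toT {n m : ℕ} (u : OrdConf n m) : Tspace n m :=
  Quotient.mk (Tsetoid n m) (toS u)

theorem isQuotientMap_toT (n m : ℕ) : IsQuotientMap (toT : OrdConf n m → Tspace n m) := by
  have h1 : IsOpenQuotientMap (Pi.map fun _ : Fin (m + 1) => (symMk : (Fin n → ℝ) → SymDiv n)) :=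
    IsOpenQuotientMap.piMap fun _ => isOpenQuotientMap_symMk n
  have h2 := (h1.restrictPreimage (Sspace n m)).isQuotientMap
  have he : (Pi.map fun _ : Fin (m + 1) => (symMk : (Fin n → ℝ) → SymDiv n)) ⁻¹' Sspace n m =
      OrdConf n m := by
    ext u
    exact symMk_mem_Sspace_iff u
  have h3 : IsQuotientMap (toS : OrdConf n m → Sspace n m) :=
    h2.comp (Homeomorph.setCongr he.symm).isQuotientMap
  have h4 : IsQuotientMap (Quotient.mk (Tsetoid n m) : Sspace n m → Tspace n m) :=
    isQuotientMap_quotient_mk'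
  exact h4.comp h3

theorem toT_eq_toT_iff {n m : ℕ} (u w : OrdConf n m) :
    toT u = toT w ↔ ∀ i, ParityEquiv (u.1 i) (w.1 i) := by
  simp only [parityEquiv_iff, ← multOf_symMk]
  refine ⟨fun h i x => ?_, fun h => Quotient.sound ?_⟩
  · exact congrFun (congrFun (Quotient.exact h : (Tsetoid n m) (toS u) (toS w)) i) x
  · exact funext fun i => funext fun x => h i x

theorem eventually_gap {ι : Type*} [Finite ι] (u : ι → ℝ) :
    ∀ᶠ δ : ℝ in 𝓝[>] 0, ∀ a b, u a ≠ u b → 3 * δ ≤ |u a - u b| := by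
  simp only [eventually_all]
  intro a b h
  have hp : 0 < |u a - u b| := abs_pos.2 (sub_ne_zero.2 h)
  filter_upwards [Ioo_mem_nhdsGT (show 0 < |u a - u b| / 3 by positivity)] with δ hδ
  linarith [hδ.2]

theorem exists_le_abs_sub_of_gap {n m : ℕ} {u : Fin (m + 1) → Fin n → ℝ} (hu : u ∈ OrdConf n m)
    {δ : ℝ} (hδ : 0 < δ)
    (hgap : ∀ a b : Fin (m + 1) × Fin n, u a.1 a.2 ≠ u b.1 b.2 →
      3 * δ ≤ |u a.1 a.2 - u b.1 b.2|) (x : ℝ) :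
    ∃ i, ∀ j, δ ≤ |x - u i j| := by
  by_contra! h
  obtain ⟨j₀, hj₀⟩ := h 0
  obtain ⟨i, hi⟩ := hu (u 0 j₀)
  obtain ⟨j, hj⟩ := h i
  have h1 := hgap (i, j) (0, j₀) (hi j)
  simp only [abs_lt] at hj hj₀
  have h2 : |u i j - u 0 j₀| < 3 * δ := by rw [abs_lt]; constructor <;> linarith [hj.1]
  linarith

theorem eventually_exists_le_abs_sub {n m : ℕ} {u : Fin (m + 1) → Fin n → ℝ}
    (hu : u ∈ OrdConf n m) : ∀ᶠ δ : ℝ in 𝓝[>] 0, ∀ x, ∃ i, ∀ j, δ ≤ |x - u i j| := by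
  filter_upwards [eventually_gap fun a : Fin (m + 1) × Fin n => u a.1 a.2, self_mem_nhdsWithin]
    with δ hδ h0 x
  exact exists_le_abs_sub_of_gap hu h0 hδ x

theorem eventually_forall_abs_sub_lt {n m : ℕ} (u : Fin (m + 1) → Fin n → ℝ) {δ : ℝ} (hδ : 0 < δ) :
    ∀ᶠ v in 𝓝 u, ∀ i j, |v i j - u i j| < δ := by
  simp only [eventually_all]
  intro i j
  have hc : ContinuousAt (fun v : Fin (m + 1) → Fin n → ℝ => |v i j - u i j|) u :=
    ((continuous_apply_apply i j).sub continuous_const).abs.continuousAt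
  exact hc.eventually (gt_mem_nhds (by simpa using hδ))

theorem isOpen_OrdConf (n m : ℕ) : IsOpen (OrdConf n m) := by
  refine isOpen_iff_mem_nhds.2 fun u hu => ?_
  obtain ⟨δ, hδ, h0⟩ := ((eventually_exists_le_abs_sub hu).and self_mem_nhdsWithin).exists
  filter_upwards [eventually_forall_abs_sub_lt u h0] with v hv x
  obtain ⟨i, hi⟩ := hδ x
  refine ⟨i, fun j hj => ?_⟩
  have h1 := hi j
  have h2 := hv i j
  rw [hj] at h2
  linarith

theorem even_occ_of_rightSign_eq {n : ℕ} {v w : Fin n → ℝ} {η : ℝ}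
    (h : ∀ y, (∀ j, η < |y - v j|) → rightSign w y = rightSign v y) {a : ℝ}
    (ha : ∀ j, η < |a - v j|) (hη : 0 ≤ η) : Even (occ w a) := by
  have hlt : ∀ c : ℝ, ∀ᶠ y in 𝓝[<] a, c < a → c < y := fun c => by
    by_cases hc : c < a
    · filter_upwards [Ioo_mem_nhdsLT hc] with y hy _ using hy.1
    · exact Eventually.of_forall fun y h => absurd h hc
  have hfar : ∀ᶠ y in 𝓝[<] a, ∀ j, η < |y - v j| := by
    refine nhdsWithin_le_nhds (eventually_all.2 fun j => ?_)
    have hc : ContinuousAt (fun y : ℝ => |y - v j|) a := by fun_prop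
    exact hc.eventually (lt_mem_nhds (ha j))
  have hw : ∀ᶠ y in 𝓝[<] a, ∀ j, w j < a → w j < y := eventually_all.2 fun j => hlt (w j)
  have hv : ∀ᶠ y in 𝓝[<] a, ∀ j, v j < a → v j < y := eventually_all.2 fun j => hlt (v j)
  obtain ⟨y, ⟨⟨hy1, hy2⟩, hy3⟩, hy4⟩ := (((hfar.and hw).and hv).and self_mem_nhdsWithin).exists
  have hya : y < a := hy4
  have h1 : rightSign w y * rightSign w a = rightSign v y * rightSign v a := by
    rw [h y hy1, h a ha]
  rw [rightSign_mul_rightSign w hya.le, rightSign_mul_rightSign v hya.le] at h1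
  have h2 : ∏ j, (if y < w j ∧ w j ≤ a then (-1 : ℤˣ) else 1) = (-1) ^ occ w a := by
    rw [← prod_sign_eq_neg_one_pow_occ]
    refine Finset.prod_congr rfl fun j _ => if_congr ⟨fun hj => ?_, fun hj => ?_⟩ rfl rfl
    · exact le_antisymm hj.2 (not_lt.1 fun h' => (hy2 j h').not_gt hj.1)
    · exact ⟨hj ▸ hya, hj.le⟩
  have h3 : ∏ j, (if y < v j ∧ v j ≤ a then (-1 : ℤˣ) else 1) = 1 := by
    refine Finset.prod_eq_one fun j _ => if_neg fun hj => ?_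
    rcases hj.2.lt_or_eq with h' | h'
    · exact (hy3 j h').not_gt hj.1
    · have := ha j
      rw [h', sub_self, abs_zero] at this
      linarith
  rw [h2, h3] at h1
  have := mod_two_eq_of_neg_one_pow_eq (l := 0) (by rw [h1, pow_zero])
  exact Nat.even_iff.2 this

/-- A configuration whose right sign agrees with that of `v` away from the `η`-neighbourhood of
`v` is parity equivalent to one contained in that neighbourhood. -/
theorem exists_parityEquiv_near {n : ℕ} (hn : 0 < n) {v w : Fin n → ℝ} {η : ℝ} (hη : 0 ≤ η)
    (h : ∀ y, (∀ j, η < |y - v j|) → rightSign w y = rightSign v y) :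
    ∃ w' : Fin n → ℝ, ParityEquiv w' w ∧ ∀ j, ∃ l, |w' j - v l| ≤ η := by
  let ψ : ℝ → ℝ := fun y => if ∃ l, |y - v l| ≤ η then y else v ⟨0, hn⟩
  refine ⟨fun j => ψ (w j), fun g => ?_, fun j => ?_⟩
  · have key : ∏ j, g (ψ (w j)) * g (w j) = 1 := by
      rw [prod_eq_prod_pow_occ w (fun y => g (ψ y) * g y) (Finset.univ.image w) (by simp)]
      refine Finset.prod_eq_one fun a _ => ?_
      by_cases ha : ∃ l, |a - v l| ≤ η
      · simp [ψ, ha]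
      · push Not at ha
        rw [units_pow_eq_of_mod_two (l := 0) _
          (Nat.even_iff.1 (even_occ_of_rightSign_eq h ha hη)), pow_zero]
    rw [Finset.prod_mul_distrib] at key
    rw [mul_eq_one_iff_eq_inv] at key
    simpa using key
  · simp only [ψ]
    split_ifs with hj
    · exact hj
    · exact ⟨⟨0, hn⟩, by simpa using hη⟩

theorem parityEquiv_of_near {n : ℕ} {v w : Fin n → ℝ} {η : ℝ} (hη : 0 < η)
    (hgap : ∀ j l, v j ≠ v l → 3 * η ≤ |v j - v l|)
    (h : ∀ y, (∀ j, η < |y - v j|) → rightSign w y = rightSign v y)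
    {l : Fin n → Fin n} (hl : ∀ j, |w j - v (l j)| ≤ η) :
    ParityEquiv (fun j => v (l j)) v := by
  refine (parityEquiv_iff _ _).2 fun a => ?_
  by_cases ha : ∃ k, v k = a
  swap
  · push Not at ha
    rw [occ_eq_zero_iff.2 ha, occ_eq_zero_iff.2 fun j => ha (l j)]
  obtain ⟨k, rfl⟩ := ha
  have hfar : ∀ y, |y - v k| = 3 / 2 * η → ∀ j, η < |y - v j| := fun y hy j => by
    by_cases hj : v k = v j
    · rw [← hj, hy]
      linarith
    · have h1 := hgap k j hj
      have h2 := abs_sub_le (v k) y (v j)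
      rw [abs_sub_comm (v k) y] at h2
      linarith
  have hle : v k - 3 / 2 * η ≤ v k + 3 / 2 * η := by linarith
  have h1 : rightSign w (v k - 3 / 2 * η) * rightSign w (v k + 3 / 2 * η) =
      rightSign v (v k - 3 / 2 * η) * rightSign v (v k + 3 / 2 * η) := by
    rw [h _ (hfar _ ?_), h _ (hfar _ ?_)]
    · rw [add_sub_cancel_left, abs_of_pos (by positivity)]
    · rw [sub_sub_cancel_left, abs_neg, abs_of_pos (by positivity)]
  rw [rightSign_mul_rightSign w hle, rightSign_mul_rightSign v hle] at h1
  refine mod_two_eq_of_neg_one_pow_eq ?_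
  rw [← prod_sign_eq_neg_one_pow_occ, ← prod_sign_eq_neg_one_pow_occ]
  convert h1 using 2 with j _ j _
  · refine if_congr ⟨fun hj => ?_, fun hj => ?_⟩ rfl rfl
    · have := hl j
      rw [hj, abs_le] at this
      constructor <;> linarith [this.1, this.2]
    · by_contra hne
      have h2 := hgap _ _ hne
      have h3 := hl j
      rw [abs_le] at h3
      rw [le_abs] at h2
      rcases h2 with h2 | h2 <;> linarith [hj.1, hj.2, h3.1, h3.2]
  · refine if_congr ⟨fun hj => ?_, fun hj => ?_⟩ rfl rfl
    · rw [hj]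
      constructor <;> linarith
    · by_contra hne
      have h2 := hgap _ _ hne
      rw [le_abs] at h2
      rcases h2 with h2 | h2 <;> linarith [hj.1, hj.2]

/-- Neighbourhoods in `T(n,m)` detected by signs away from a small neighbourhood of a given
representative. -/
theorem eventually_toT_mem {n m : ℕ} (hn : 0 < n) (u : OrdConf n m) {O : Set (Tspace n m)}
    (hO : IsOpen O) (hu : toT u ∈ O) :
    ∀ᶠ η : ℝ in 𝓝[>] 0, ∀ w : OrdConf n m,
      (∀ i y, (∀ j, η < |y - u.1 i j|) → rightSign (w.1 i) y = rightSign (u.1 i) y) →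
      toT w ∈ O := by
  have hopen : IsOpen (Subtype.val '' (toT ⁻¹' O : Set (OrdConf n m))) :=
    (isOpen_OrdConf n m).isOpenMap_subtype_val _
      (hO.preimage (isQuotientMap_toT n m).continuous)
  have hball : ∀ᶠ η : ℝ in 𝓝[>] 0, ∀ t : Fin (m + 1) → Fin n → Fin n,
      (∀ i, ParityEquiv (fun j => u.1 i (t i j)) (u.1 i)) →
      ∀ v : Fin (m + 1) → Fin n → ℝ, (∀ i j, |v i j - u.1 i (t i j)| ≤ η) →
        v ∈ Subtype.val '' (toT ⁻¹' O : Set (OrdConf n m)) := by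
    refine eventually_all.2 fun t => ?_
    by_cases ht : ∀ i, ParityEquiv (fun j => u.1 i (t i j)) (u.1 i)
    swap
    · exact Eventually.of_forall fun η h => absurd h ht
    let v₀ : OrdConf n m := ⟨fun i j => u.1 i (t i j), fun x => by
      obtain ⟨i, hi⟩ := u.2 x
      exact ⟨i, fun j => hi _⟩⟩
    have hv₀ : v₀.1 ∈ Subtype.val '' (toT ⁻¹' O : Set (OrdConf n m)) :=
      ⟨v₀, by rwa [mem_preimage, (toT_eq_toT_iff v₀ u).2 ht], rfl⟩
    obtain ⟨r, hr, hsub⟩ := Metric.isOpen_iff.1 hopen _ hv₀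
    filter_upwards [Ioo_mem_nhdsGT hr] with η hη _ v hv
    refine hsub (Metric.mem_ball.2 (lt_of_le_of_lt ?_ hη.2))
    exact (dist_pi_le_iff hη.1.le).2 fun i => (dist_pi_le_iff hη.1.le).2 fun j => hv i j
  filter_upwards [hball, eventually_gap fun a : Fin (m + 1) × Fin n => u.1 a.1 a.2,
    self_mem_nhdsWithin] with η hη hgap h0 w hw
  have h0' : 0 < η := h0
  choose w' hw' hnear using fun i => exists_parityEquiv_near hn h0'.le (hw i)
  choose t ht using hnear
  have hpar : ∀ i, ParityEquiv (fun j => u.1 i (t i j)) (u.1 i) := fun i =>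
    parityEquiv_of_near h0' (fun j l => hgap (i, j) (i, l))
      (fun y hy => ((hw' i).rightSign_eq y).trans (hw i y hy)) (ht i)
  obtain ⟨v, hv, hvw⟩ := hη t hpar w' ht
  have : toT w = toT v := (toT_eq_toT_iff w v).2 fun i => by
    rw [hvw]
    exact (hw' i).symm
  rw [this]
  exact hv

open Polynomial in
/-- The monic polynomial of degree `n` obtained from the integer points `k j` scaled by `ε`:
points of odd multiplicity are kept as simple roots, and cancelled pairs are replaced by the
positive factor `x^2 + 1`. -/
def roundPoly {n : ℕ} (k : Fin n → ℤ) (ε : ℝ) : ℝ[X] :=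
  (∏ b ∈ (Finset.univ.image k).filter fun b => Odd (occ k b), (X - C (ε * b))) *
    (X ^ 2 + C 1) ^ ((n - ((Finset.univ.image k).filter fun b => Odd (occ k b)).card) / 2)

theorem card_oddPoints {n : ℕ} (k : Fin n → ℤ) :
    ((Finset.univ.image k).filter fun b => Odd (occ k b)).card +
      2 * ((n - ((Finset.univ.image k).filter fun b => Odd (occ k b)).card) / 2) = n := by
  set s := (Finset.univ.image k).filter fun b => Odd (occ k b) with hs
  have hsum : ∑ b ∈ Finset.univ.image k, occ k b = n := by
    have := Finset.card_eq_sum_card_image k (Finset.univ : Finset (Fin n))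
    rw [Finset.card_univ, Fintype.card_fin] at this
    convert this.symm
    unfold occ
    congr!
  have hle : s.card ≤ n :=
    (Finset.card_filter_le _ _).trans (Finset.card_image_le.trans (by simp))
  have hpar : Odd n ↔ Odd s.card := by
    rw [hs, ← Finset.odd_sum_iff_odd_card_odd, hsum]
  rw [Nat.odd_iff, Nat.odd_iff] at hpar
  omega

theorem mem_oddPoints {n : ℕ} (k : Fin n → ℤ) (b : ℤ) :
    b ∈ ((Finset.univ.image k).filter fun b => Odd (occ k b)) ↔ Odd (occ k b) := by
  rw [Finset.mem_filter, and_iff_right_iff_imp]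
  intro h
  obtain ⟨j, hj⟩ := Finset.card_pos.1 h.pos
  exact Finset.mem_image.2 ⟨j, Finset.mem_univ _, by simpa using hj⟩

theorem roundPoly_congr {n : ℕ} {k l : Fin n → ℤ} (h : ∀ b, occ k b % 2 = occ l b % 2) (ε : ℝ) :
    roundPoly k ε = roundPoly l ε := by
  have : ((Finset.univ.image k).filter fun b => Odd (occ k b)) =
      ((Finset.univ.image l).filter fun b => Odd (occ l b)) := by
    ext b
    rw [mem_oddPoints, mem_oddPoints, Nat.odd_iff, Nat.odd_iff, h]
  rw [roundPoly, roundPoly, this]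

theorem monic_roundPoly {n : ℕ} (k : Fin n → ℤ) (ε : ℝ) : (roundPoly k ε).Monic :=
  (Polynomial.monic_prod_of_monic _ _ fun _ _ => Polynomial.monic_X_sub_C _).mul
    ((Polynomial.monic_X_pow_add_C _ two_ne_zero).pow _)

theorem natDegree_roundPoly {n : ℕ} (k : Fin n → ℤ) (ε : ℝ) : (roundPoly k ε).natDegree = n := by
  rw [roundPoly, Polynomial.Monic.natDegree_mul
    (Polynomial.monic_prod_of_monic _ _ fun _ _ => Polynomial.monic_X_sub_C _)
    ((Polynomial.monic_X_pow_add_C _ two_ne_zero).pow _),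
    Polynomial.natDegree_prod_of_monic _ _ fun _ _ => Polynomial.monic_X_sub_C _,
    Polynomial.natDegree_pow, Polynomial.natDegree_X_pow_add_C]
  simp only [Polynomial.natDegree_X_sub_C, Finset.sum_const, smul_eq_mul, mul_one]
  rw [mul_comm _ 2]
  exact card_oddPoints k

theorem eval_eq_of_monic {n : ℕ} {p : Polynomial ℝ} (hp : p.Monic) (hd : p.natDegree = n) (x : ℝ) :
    p.eval x = x ^ n + ∑ j : Fin n, p.coeff j * x ^ (j : ℕ) := by
  rw [Polynomial.eval_eq_sum_range, hd, Finset.sum_range_succ, ← hd, hp.coeff_natDegree, hd,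
    Finset.sum_range, one_mul, add_comm]

theorem continuous_coeff_mul {Y : Type*} [TopologicalSpace Y] {p q : Y → Polynomial ℝ}
    (hp : ∀ i, Continuous fun y => (p y).coeff i) (hq : ∀ i, Continuous fun y => (q y).coeff i)
    (i : ℕ) : Continuous fun y => (p y * q y).coeff i := by
  simp only [Polynomial.coeff_mul]
  exact continuous_finsetSum _ fun a _ => (hp a.1).mul (hq a.2)

theorem continuous_coeff_roundPoly {n : ℕ} (k : Fin n → ℤ) (i : ℕ) :
    Continuous fun ε => (roundPoly k ε).coeff i := by
  refine continuous_coeff_mul (fun i => ?_) (fun i => continuous_const) i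
  generalize ((Finset.univ.image k).filter fun b => Odd (occ k b)) = s
  induction s using Finset.induction_on generalizing i with
  | empty => simpa using continuous_const
  | insert b s hb ih =>
    simp only [Finset.prod_insert hb]
    refine continuous_coeff_mul (fun i => ?_) ih i
    simp only [Polynomial.coeff_sub, Polynomial.coeff_C]
    split_ifs <;> fun_prop

theorem eval_roundPoly {n : ℕ} (k : Fin n → ℤ) (ε x : ℝ) :
    (roundPoly k ε).eval x = ((rightSign (fun j => ε * k j) x : ℤˣ) : ℝ) *
      ((∏ b ∈ (Finset.univ.image k).filter fun b => Odd (occ k b), |x - ε * b|) *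
      (x ^ 2 + 1) ^ ((n - ((Finset.univ.image k).filter fun b => Odd (occ k b)).card) / 2)) := by
  let g : ℤ → ℤˣ := fun b => if x < ε * b then -1 else 1
  have h1 : rightSign (fun j => ε * k j) x =
      ∏ b ∈ (Finset.univ.image k).filter fun b => Odd (occ k b), g b := by
    change ∏ j, g (k j) = _
    rw [prod_eq_prod_pow_occ k g (Finset.univ.image k) (by simp), Finset.prod_filter]
    refine Finset.prod_congr rfl fun b _ => ?_
    split_ifs with hb
    · rw [units_pow_eq_of_mod_two (l := 1) _ (Nat.odd_iff.1 hb), pow_one]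
    · rw [units_pow_eq_of_mod_two (l := 0) _ (Nat.even_iff.1 (Nat.not_odd_iff_even.1 hb)),
        pow_zero]
  rw [h1, roundPoly, ← mul_assoc]
  push_cast
  rw [← Finset.prod_mul_distrib]
  simp only [Polynomial.eval_mul, Polynomial.eval_prod, Polynomial.eval_pow, Polynomial.eval_add,
    Polynomial.eval_sub, Polynomial.eval_X, Polynomial.eval_C]
  congr 1
  refine Finset.prod_congr rfl fun b _ => ?_
  by_cases hb : x < ε * b
  · simp [g, hb, abs_of_neg (sub_neg.2 hb)]
  · simp [g, hb, abs_of_nonneg (sub_nonneg.2 (not_lt.1 hb))]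

/-- The indices of the cells of the grid of mesh `ε` and offset `θ` containing the points of
`u`. -/
def roundIdx {n : ℕ} (u : Fin n → ℝ) (ε θ : ℝ) : Fin n → ℤ :=
  fun j => ⌊u j / ε + θ⌋

/-- The coefficients of the average over all grid offsets of the polynomials obtained by rounding
`u` to the grid of mesh `ε` and cancelling coinciding pairs. -/
def roundCoeff {n : ℕ} (u : Fin n → ℝ) (ε : ℝ) : Fin n → ℝ :=
  fun i => ∫ θ in (0 : ℝ)..1, (roundPoly (roundIdx u ε θ) ε).coeff i

theorem roundCoeff_congr {n : ℕ} {u w : Fin n → ℝ} (h : ParityEquiv u w) (ε : ℝ) :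
    roundCoeff u ε = roundCoeff w ε := by
  funext i
  refine intervalIntegral.integral_congr fun θ _ => ?_
  rw [roundPoly_congr fun b => mod_two_eq_of_neg_one_pow_eq ?_]
  rw [← prod_sign_eq_neg_one_pow_occ, ← prod_sign_eq_neg_one_pow_occ]
  convert h fun y => if ⌊y / ε + θ⌋ = b then -1 else 1 <;> rfl

theorem measurable_roundIdx {n : ℕ} (u : Fin n → ℝ) (ε : ℝ) : Measurable (roundIdx u ε) :=
  measurable_pi_lambda _ fun j => Int.measurable_floor.comp (measurable_const_add (u j / ε))

theorem measurable_comp_roundIdx {n : ℕ} (u : Fin n → ℝ) (ε : ℝ) (F : (Fin n → ℤ) → ℝ) :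
    Measurable fun θ => F (roundIdx u ε θ) :=
  (Measurable.of_discrete (f := F)).comp (measurable_roundIdx u ε)

theorem eventually_roundIdx_mem {n : ℕ} (u : Fin n → ℝ) {ε : ℝ} (hε : ε ≠ 0) :
    ∃ K : Finset (Fin n → ℤ), ∀ᶠ p : (Fin n → ℝ) × ℝ in 𝓝 (u, ε),
      ∀ θ ∈ Icc (0 : ℝ) 1, roundIdx p.1 p.2 θ ∈ K := by
  refine ⟨Fintype.piFinset fun j => Finset.Icc ⌊u j / ε - 1⌋ ⌊u j / ε + 2⌋, ?_⟩
  have : ∀ᶠ p : (Fin n → ℝ) × ℝ in 𝓝 (u, ε), ∀ j, p.1 j / p.2 ∈ Ioo (u j / ε - 1) (u j / ε + 1) := by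
    refine eventually_all.2 fun j => ?_
    have hc : ContinuousAt (fun p : (Fin n → ℝ) × ℝ => p.1 j / p.2) (u, ε) :=
      ContinuousAt.div (by fun_prop) (by fun_prop) hε
    exact hc.eventually (Ioo_mem_nhds (by simp) (by simp))
  filter_upwards [this] with p hp θ hθ
  refine Fintype.mem_piFinset.2 fun j => Finset.mem_Icc.2 ⟨?_, ?_⟩
  · exact Int.floor_le_floor (by linarith [(hp j).1, hθ.1])
  · exact Int.floor_le_floor (by linarith [(hp j).2, hθ.2])

theorem exists_bound_coeff_roundPoly {n : ℕ} (u : Fin n → ℝ) {ε : ℝ} (hε : ε ≠ 0) (i : ℕ) :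
    ∃ B, ∀ᶠ p : (Fin n → ℝ) × ℝ in 𝓝 (u, ε), ∀ θ ∈ Icc (0 : ℝ) 1,
      ‖(roundPoly (roundIdx p.1 p.2 θ) p.2).coeff i‖ ≤ B := by
  obtain ⟨K, hK⟩ := eventually_roundIdx_mem u hε
  refine ⟨∑ k ∈ K, (‖(roundPoly k ε).coeff i‖ + 1), ?_⟩
  have h : ∀ᶠ p : (Fin n → ℝ) × ℝ in 𝓝 (u, ε), ∀ k ∈ K,
      ‖(roundPoly k p.2).coeff i‖ ≤ ‖(roundPoly k ε).coeff i‖ + 1 := by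
    refine (Finset.eventually_all K).2 fun k _ => ?_
    have hc : ContinuousAt (fun p : (Fin n → ℝ) × ℝ => ‖(roundPoly k p.2).coeff i‖) (u, ε) :=
      ((continuous_coeff_roundPoly k i).comp continuous_snd).norm.continuousAt
    filter_upwards [hc.eventually (gt_mem_nhds (lt_add_one _))] with p hp using hp.le
  filter_upwards [hK, h] with p hp1 hp2 θ hθ
  refine (hp2 _ (hp1 θ hθ)).trans ?_
  exact Finset.single_le_sum (f := fun k => ‖(roundPoly k ε).coeff i‖ + 1)
    (fun k _ => by positivity) (hp1 θ hθ)

theorem intervalIntegrable_coeff_roundPoly {n : ℕ} (u : Fin n → ℝ) {ε : ℝ} (hε : ε ≠ 0) (i : ℕ) :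
    IntervalIntegrable (fun θ => (roundPoly (roundIdx u ε θ) ε).coeff i) MeasureTheory.volume
      0 1 := by
  obtain ⟨B, hB⟩ := exists_bound_coeff_roundPoly u hε i
  refine (intervalIntegrable_const (c := B)).mono_fun
    (measurable_comp_roundIdx u ε fun k => (roundPoly k ε).coeff i).aestronglyMeasurable ?_
  refine (MeasureTheory.ae_restrict_iff' measurableSet_uIoc).2 (Eventually.of_forall fun θ hθ => ?_)
  rw [uIoc_of_le zero_le_one] at hθ
  exact (hB.self_of_nhds θ ⟨hθ.1.le, hθ.2⟩).trans (le_abs_self B)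

theorem continuousAt_roundCoeff {n : ℕ} (u : Fin n → ℝ) {ε : ℝ} (hε : ε ≠ 0) :
    ContinuousAt (fun p : (Fin n → ℝ) × ℝ => roundCoeff p.1 p.2) (u, ε) := by
  refine continuousAt_pi.2 fun i => ?_
  obtain ⟨B, hB⟩ := exists_bound_coeff_roundPoly u hε i
  refine intervalIntegral.continuousAt_of_dominated_interval (bound := fun _ => B) ?_ ?_
    intervalIntegrable_const ?_
  · exact Eventually.of_forall fun p =>
      (measurable_comp_roundIdx p.1 p.2 fun k => (roundPoly k p.2).coeff i).aestronglyMeasurable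
  · filter_upwards [hB] with p hp
    refine Eventually.of_forall fun θ hθ => ?_
    rw [uIoc_of_le zero_le_one] at hθ
    exact hp θ ⟨hθ.1.le, hθ.2⟩
  · have hcount : (⋃ j : Fin n, range fun z : ℤ => (z : ℝ) - u j / ε).Countable :=
      countable_iUnion fun j => countable_range _
    filter_upwards [hcount.ae_notMem MeasureTheory.volume] with θ hθ _
    have hfl : ∀ᶠ p : (Fin n → ℝ) × ℝ in 𝓝 (u, ε), roundIdx p.1 p.2 θ = roundIdx u ε θ := by
      have : ∀ᶠ p : (Fin n → ℝ) × ℝ in 𝓝 (u, ε), ∀ j,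
          p.1 j / p.2 + θ ∈ Ioo (⌊u j / ε + θ⌋ : ℝ) (⌊u j / ε + θ⌋ + 1) := by
        refine eventually_all.2 fun j => ?_
        have hc : ContinuousAt (fun p : (Fin n → ℝ) × ℝ => p.1 j / p.2 + θ) (u, ε) :=
          (ContinuousAt.div (by fun_prop) (by fun_prop) hε).add continuousAt_const
        refine hc.eventually (Ioo_mem_nhds ?_ (Int.lt_floor_add_one _))
        refine lt_of_le_of_ne (Int.floor_le _) fun h => hθ (mem_iUnion.2 ⟨j, ⌊u j / ε + θ⌋, ?_⟩)
        change (⌊u j / ε + θ⌋ : ℝ) - u j / ε = θ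
        simp only at h
        linarith
      filter_upwards [this] with p hp
      funext j
      exact Int.floor_eq_iff.2 ⟨(hp j).1.le, (hp j).2⟩
    refine ContinuousAt.congr
      (f := fun p : (Fin n → ℝ) × ℝ => (roundPoly (roundIdx u ε θ) p.2).coeff i)
      ((continuous_coeff_roundPoly _ i).comp continuous_snd).continuousAt ?_
    filter_upwards [hfl] with p hp
    rw [hp]

theorem evalMonic_roundCoeff {n : ℕ} (u : Fin n → ℝ) {ε : ℝ} (hε : ε ≠ 0) (x : ℝ) :
    evalMonic n (roundCoeff u ε) x =
      ∫ θ in (0 : ℝ)..1, (roundPoly (roundIdx u ε θ) ε).eval x := by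
  have hi : ∀ i : Fin n, IntervalIntegrable
      (fun θ => (roundPoly (roundIdx u ε θ) ε).coeff i * x ^ (i : ℕ)) MeasureTheory.volume 0 1 :=
    fun i => (intervalIntegrable_coeff_roundPoly u hε i).mul_const _
  simp only [eval_eq_of_monic (monic_roundPoly _ ε) (natDegree_roundPoly _ ε)]
  rw [intervalIntegral.integral_add intervalIntegrable_const
    (by simpa only [Finset.sum_fn] using IntervalIntegrable.sum Finset.univ fun i _ => hi i),
    intervalIntegral.integral_finsetSum fun i _ => hi i]
  simp [evalMonic, roundCoeff, intervalIntegral.integral_mul_const]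

theorem rightSign_congr {n : ℕ} {u w : Fin n → ℝ} {y : ℝ} (h : ∀ j, y < u j ↔ y < w j) :
    rightSign u y = rightSign w y :=
  Finset.prod_congr rfl fun j _ => if_congr (h j) rfl rfl

theorem pow_le_rightSign_mul_evalMonic {n : ℕ} (u : Fin n → ℝ) {ε x : ℝ} (hε : 0 < ε)
    (hε1 : ε ≤ 1) (h : ∀ j, 2 * ε ≤ |x - u j|) :
    ε ^ n ≤ ((rightSign u x : ℤˣ) : ℝ) * evalMonic n (roundCoeff u ε) x := by
  have hpt : ∀ θ ∈ Icc (0 : ℝ) 1,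
      ε ^ n ≤ ((rightSign u x : ℤˣ) : ℝ) * (roundPoly (roundIdx u ε θ) ε).eval x := by
    intro θ hθ
    have hclose : ∀ j, |ε * roundIdx u ε θ j - u j| ≤ ε := fun j => by
      have h1 := Int.floor_le (u j / ε + θ)
      have h2 := Int.lt_floor_add_one (u j / ε + θ)
      have h3 : ε * (u j / ε) = u j := by field_simp
      rw [abs_le]
      simp only [roundIdx]
      constructor <;> nlinarith [hθ.1, hθ.2]
    have hsign : rightSign (fun j => ε * (roundIdx u ε θ j : ℝ)) x = rightSign u x :=
      rightSign_congr fun j => by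
        have h1 := h j
        have h2 := abs_le.1 (hclose j)
        rcases le_abs.1 h1 with h1 | h1
        · constructor <;> intro h3 <;> linarith [h2.1, h2.2]
        · constructor <;> intro h3 <;> linarith [h2.1, h2.2]
    rw [eval_roundPoly, hsign, ← mul_assoc]
    have hsq : ((rightSign u x : ℤˣ) : ℝ) * ((rightSign u x : ℤˣ) : ℝ) = 1 := by
      rcases Int.units_eq_one_or (rightSign u x) with h | h <;> simp [h]
    rw [hsq, one_mul]
    set s := (Finset.univ.image (roundIdx u ε θ)).filter fun b => Odd (occ (roundIdx u ε θ) b)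
    have hs : s.card ≤ n := 
      (Finset.card_filter_le _ _).trans (Finset.card_image_le.trans (by simp))
    have h1 : ε ^ s.card ≤ ∏ b ∈ s, |x - ε * b| := by
      rw [← Finset.prod_const]
      refine Finset.prod_le_prod (fun _ _ => hε.le) fun b hb => ?_
      obtain ⟨j, -, rfl⟩ := Finset.mem_image.1 (Finset.mem_filter.1 hb).1
      have h2 := abs_sub_le x (ε * roundIdx u ε θ j) (u j)
      linarith [h j, hclose j]
    have h2 : (1 : ℝ) ≤ (x ^ 2 + 1) ^ ((n - s.card) / 2) :=
      one_le_pow₀ (by nlinarith [sq_nonneg x])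
    calc ε ^ n ≤ ε ^ s.card * 1 := by rw [mul_one]; exact pow_le_pow_of_le_one hε.le hε1 hs
      _ ≤ _ := mul_le_mul h1 h2 zero_le_one ((pow_pos hε _).le.trans h1)
  rw [evalMonic_roundCoeff u hε.ne', ← intervalIntegral.integral_const_mul]
  have hevalInt : IntervalIntegrable (fun θ => (roundPoly (roundIdx u ε θ) ε).eval x)
      MeasureTheory.volume 0 1 := by
    simp only [eval_eq_of_monic (monic_roundPoly _ ε) (natDegree_roundPoly _ ε)]
    refine intervalIntegrable_const.add ?_
    simpa only [Finset.sum_fn] using IntervalIntegrable.sum Finset.univ fun (i : Fin n) _ =>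
      (intervalIntegrable_coeff_roundPoly u hε.ne' i).mul_const (x ^ (i : ℕ))
  have := intervalIntegral.integral_mono_on zero_le_one
    (intervalIntegrable_const (c := ε ^ n)) (hevalInt.const_mul _) hpt
  simpa using this

theorem exists_tuple_of_card_eq {n : ℕ} (M : Multiset ℝ) (h : M.card = n) :
    ∃ u : Fin n → ℝ, Multiset.map u Finset.univ.val = M := by
  obtain ⟨l, rfl⟩ : ∃ l : List ℝ, (l : Multiset ℝ) = M := ⟨M.toList, M.coe_toList⟩
  rw [Multiset.coe_card] at h
  subst h
  exact ⟨l.get, by rw [Fin.univ_val_map, List.ofFn_get]⟩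

theorem eval_pos_of_monic_of_roots_eq_zero {q : Polynomial ℝ} (hq : q.Monic)
    (h : q.roots = 0) (y : ℝ) : 0 < q.eval y := by
  have hroot : ∀ x, q.eval x ≠ 0 := fun x hx => by
    have := (Polynomial.mem_roots hq.ne_zero).2 hx
    rw [h] at this
    exact Multiset.notMem_zero _ this
  by_contra! hy
  rcases Nat.eq_zero_or_pos q.natDegree with hd | hd
  · rw [hq.natDegree_eq_zero.1 hd, Polynomial.eval_one] at hy
    linarith
  · have ht := Polynomial.tendsto_atTop_of_leadingCoeff_nonneg q
      (Polynomial.natDegree_pos_iff_degree_pos.1 hd) (by rw [hq.leadingCoeff]; exact zero_le_one)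
    obtain ⟨z, hz⟩ := (ht.eventually_ge_atTop 0).exists
    obtain ⟨x, hx⟩ := mem_range_of_exists_le_of_exists_ge q.continuous ⟨y, hy⟩ ⟨z, hz⟩
    exact hroot x hx

theorem even_natDegree_of_roots_eq_zero {q : Polynomial ℝ} (hq : q.Monic)
    (h : q.roots = 0) : Even q.natDegree := by
  rw [← Nat.not_odd_iff_even]
  intro hodd
  have hlead : (-q.comp (-Polynomial.X)).Monic := by
    rw [Polynomial.Monic, Polynomial.leadingCoeff_neg, Polynomial.leadingCoeff_comp (by simp)]
    simp [hq.leadingCoeff, hodd.neg_one_pow]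
  have hroots : (-q.comp (-Polynomial.X)).roots = 0 := by
    refine Multiset.eq_zero_of_forall_notMem fun x hx => ?_
    have h1 := (Polynomial.mem_roots hlead.ne_zero).1 hx
    have h2 := eval_pos_of_monic_of_roots_eq_zero hq h (-x)
    simp only [Polynomial.IsRoot, Polynomial.eval_neg, Polynomial.eval_comp,
      Polynomial.eval_X] at h1
    linarith
  have h1 := eval_pos_of_monic_of_roots_eq_zero hq h 0
  have h2 := eval_pos_of_monic_of_roots_eq_zero hlead hroots 0
  simp only [Polynomial.eval_neg, Polynomial.eval_comp, Polynomial.eval_X, neg_zero] at h2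
  linarith

/-- The real roots of a monic polynomial of degree `n`, padded by an even number of copies of
`a` to an `n`-tuple. -/
theorem exists_padded_roots {n : ℕ} {p : Polynomial ℝ} (hp : p.Monic) (hd : p.natDegree = n)
    (a : ℝ) : ∃ u : Fin n → ℝ, (∀ j, p.eval (u j) = 0 ∨ u j = a) ∧
      (∀ x, p.eval x = 0 → ∃ j, u j = x) ∧
      (∀ x, occ u x % 2 = p.rootMultiplicity x % 2) ∧
      ∀ y, 0 ≤ ((rightSign u y : ℤˣ) : ℝ) * p.eval y := by
  obtain ⟨q, hmul, hdeg, hroots⟩ := Polynomial.exists_prod_multiset_X_sub_C_mul p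
  have hq : q.Monic := by
    refine Polynomial.Monic.of_mul_monic_left (Polynomial.monic_multiset_prod_of_monic p.roots
      (fun a => Polynomial.X - Polynomial.C a) fun a _ => Polynomial.monic_X_sub_C a) ?_
    rw [hmul]
    exact hp
  have heven := even_natDegree_of_roots_eq_zero hq hroots
  obtain ⟨u, hu⟩ := exists_tuple_of_card_eq (n := n)
    (p.roots + Multiset.replicate q.natDegree a) (by simp [hdeg, hd])
  have hmem : ∀ x, (∃ j, u j = x) ↔ (p.eval x = 0 ∨ (q.natDegree ≠ 0 ∧ x = a)) := fun x => by
    have : (∃ j, u j = x) ↔ x ∈ Multiset.map u Finset.univ.val := by simp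
    rw [this, hu, Multiset.mem_add, Polynomial.mem_roots hp.ne_zero, Multiset.mem_replicate,
      Polynomial.IsRoot]
  refine ⟨u, fun j => ((hmem _).1 ⟨j, rfl⟩).imp id And.right, fun x hx => (hmem x).2 (Or.inl hx),
    fun x => ?_, fun y => ?_⟩
  · have : occ u x = Multiset.count x (Multiset.map u Finset.univ.val) := by
      rw [Multiset.count_map]
      simp only [occ, Finset.card, Finset.filter_val, eq_comm]
    rw [this, hu, Multiset.count_add, Polynomial.count_roots, Multiset.count_replicate]
    have := Nat.even_iff.1 heven
    split_ifs <;> omega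
  · let s : ℝ → ℤˣ := fun z => if y < z then -1 else 1
    have h1 : rightSign u y = (p.roots.map s).prod := by
      have : rightSign u y = ((Multiset.map u Finset.univ.val).map s).prod := by
        rw [Multiset.map_map]
        rfl
      rw [this, hu, Multiset.map_add, Multiset.prod_add, Multiset.map_replicate,
        Multiset.prod_replicate,
        units_pow_eq_of_mod_two (l := 0) _ (Nat.even_iff.1 heven), pow_zero, mul_one]
    have h2 : p.eval y = (p.roots.map fun r => y - r).prod * q.eval y := by
      conv_lhs => rw [← hmul]
      rw [Polynomial.eval_mul, Polynomial.eval_multiset_prod, Multiset.map_map]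
      simp
    have h3 : ((rightSign u y : ℤˣ) : ℝ) = (p.roots.map fun r => ((s r : ℤˣ) : ℝ)).prod := by
      rw [h1]
      generalize p.roots = M
      induction M using Multiset.induction_on with
      | empty => simp
      | cons r M ih => simp [ih]
    rw [h2, h3, ← mul_assoc, ← Multiset.prod_map_mul]
    refine mul_nonneg (Multiset.prod_nonneg fun z hz => ?_)
      (eval_pos_of_monic_of_roots_eq_zero hq hroots y).le
    obtain ⟨r, -, rfl⟩ := Multiset.mem_map.1 hz
    by_cases hr : y < r
    · simp [s, hr, hr.le]
    · have := not_lt.1 hr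
      simp [s, hr, this]

theorem polyOf_eval (n : ℕ) (c : Fin n → ℝ) (x : ℝ) : (polyOf n c).eval x = evalMonic n c x := by
  simp [polyOf, evalMonic, Polynomial.eval_finsetSum]

theorem degree_sum_lt (n : ℕ) (c : Fin n → ℝ) :
    (∑ j : Fin n, Polynomial.C (c j) * Polynomial.X ^ (j : ℕ)).degree < (n : WithBot ℕ) := by
  rw [Polynomial.degree_lt_iff_coeff_zero]
  intro k hk
  simp only [Polynomial.finsetSum_coeff, Polynomial.coeff_C_mul, Polynomial.coeff_X_pow]
  refine Finset.sum_eq_zero fun j _ => ?_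
  rw [if_neg (by have := j.2; omega), mul_zero]

theorem monic_polyOf (n : ℕ) (c : Fin n → ℝ) : (polyOf n c).Monic :=
  Polynomial.monic_X_pow_add (degree_sum_lt n c)

theorem natDegree_polyOf (n : ℕ) (c : Fin n → ℝ) : (polyOf n c).natDegree = n :=
  Polynomial.natDegree_eq_of_degree_eq_some <| by
    rw [polyOf, Polynomial.degree_add_eq_left_of_degree_lt] <;> rw [Polynomial.degree_X_pow]
    exact degree_sum_lt n c

/-- An ordered configuration representing the real root divisors of a tuple of polynomials
without common root; all real roots of all polynomials occur in it. -/
theorem exists_rootConf {n m : ℕ} (hm : 1 ≤ m) (c : Dspace n m) :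
    ∃ u : OrdConf n m, (∀ i x, evalMonic n (c.1 i) x = 0 → ∃ j, u.1 i j = x) ∧
      (∀ i x, occ (u.1 i) x % 2 = (polyOf n (c.1 i)).rootMultiplicity x % 2) ∧
      ∀ i y, 0 ≤ ((rightSign (u.1 i) y : ℤˣ) : ℝ) * evalMonic n (c.1 i) y := by
  obtain ⟨R, hR⟩ : ∃ R : ℝ, ∀ i x, evalMonic n (c.1 i) x = 0 → x < R := by
    have hfin : (⋃ i, {x | evalMonic n (c.1 i) x = 0}).Finite := by
      refine finite_iUnion fun i => ?_
      simp only [← polyOf_eval]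
      exact Polynomial.finite_setOfPred_isRoot (monic_polyOf n (c.1 i)).ne_zero
    obtain ⟨R, hR⟩ := hfin.bddAbove
    exact ⟨R + 1, fun i x hx => lt_of_le_of_lt (hR (mem_iUnion.2 ⟨i, hx⟩)) (lt_add_one R)⟩
  choose u h1 h2 h3 h4 using fun i => exists_padded_roots (monic_polyOf n (c.1 i))
    (natDegree_polyOf n (c.1 i)) (R + (i : ℕ))
  simp only [polyOf_eval] at h1 h2 h4
  refine ⟨⟨u, fun x => ?_⟩, h2, h3, h4⟩
  by_contra! h
  by_cases hx : ∃ i : Fin (m + 1), x = R + (i : ℕ)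
  · obtain ⟨i, rfl⟩ := hx
    obtain ⟨k, hk⟩ : ∃ k : Fin (m + 1), k ≠ i := by
      have : Nontrivial (Fin (m + 1)) := Fin.nontrivial_iff_two_le.2 (by omega)
      exact exists_ne i
    obtain ⟨j, hj⟩ := h k
    rcases h1 k j with h' | h' <;> rw [hj] at h'
    · have := hR k _ h'
      have h0 : (0 : ℝ) ≤ ((i : ℕ) : ℝ) := Nat.cast_nonneg _
      linarith
    · have h5 : ((i : ℕ) : ℝ) = ((k : ℕ) : ℝ) := by linarith
      exact hk (Fin.ext (by exact_mod_cast h5.symm))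
  · push Not at hx
    obtain ⟨i, hi⟩ := c.2 x
    obtain ⟨j, hj⟩ := h i
    rcases h1 i j with h' | h' <;> rw [hj] at h'
    · exact hi h'
    · exact hx i h'

theorem continuous_evalMonic (n : ℕ) :
    Continuous fun p : (Fin n → ℝ) × ℝ => evalMonic n p.1 p.2 := by
  unfold evalMonic
  fun_prop

theorem pow_mul_evalMonic_pos {n : ℕ} (c : Fin n → ℝ) {x : ℝ} (hx : 1 ≤ |x|)
    (hc : ∑ j, |c j| < |x|) : 0 < x ^ n * evalMonic n c x := by
  rcases Nat.eq_zero_or_pos n with rfl | hn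
  · simp [evalMonic]
  have h1 : |∑ j : Fin n, c j * x ^ (j : ℕ)| < |x| ^ n := by
    calc |∑ j : Fin n, c j * x ^ (j : ℕ)| ≤ ∑ j : Fin n, |c j| * |x| ^ (n - 1) := by
          refine (Finset.abs_sum_le_sum_abs _ _).trans (Finset.sum_le_sum fun j _ => ?_)
          rw [abs_mul, abs_pow]
          exact mul_le_mul_of_nonneg_left (pow_le_pow_right₀ hx (by have := j.2; omega))
            (abs_nonneg _)
      _ = (∑ j, |c j|) * |x| ^ (n - 1) := by rw [Finset.sum_mul]
      _ < |x| * |x| ^ (n - 1) := by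
          exact mul_lt_mul_of_pos_right hc (pow_pos (by linarith) _)
      _ = |x| ^ n := by rw [← pow_succ', Nat.sub_add_cancel hn]
  have h2 : |x ^ n * ∑ j : Fin n, c j * x ^ (j : ℕ)| < x ^ n * x ^ n := by
    rw [abs_mul, ← abs_mul_abs_self (x ^ n), abs_pow]
    exact mul_lt_mul_of_pos_left h1 (pow_pos (by linarith) _)
  have h3 := (abs_lt.1 h2).1
  unfold evalMonic
  nlinarith

/-- Polynomials close to a given one have the same signs away from a neighbourhood of its
real roots. -/
theorem eventually_evalMonic_mul_pos {n : ℕ} (c : Fin n → ℝ) {η : ℝ} (v : Fin n → ℝ)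
    (hv : ∀ x, evalMonic n c x = 0 → ∃ j, v j = x) (hη : 0 < η) :
    ∀ᶠ d in 𝓝 c, ∀ y, (∀ j, η ≤ |y - v j|) → 0 < evalMonic n c y * evalMonic n d y := by
  set R : ℝ := ∑ j, |c j| + 1 with hR
  have hsum : ∀ᶠ d in 𝓝 c, ∑ j, |d j| < R := by
    have hc : ContinuousAt (fun d : Fin n → ℝ => ∑ j, |d j|) c :=
      (continuous_finsetSum _ fun j _ => (continuous_apply j).abs).continuousAt
    exact hc.eventually (gt_mem_nhds (lt_add_one _))
  have hR1 : 1 ≤ R := by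
    have : 0 ≤ ∑ j, |c j| := Finset.sum_nonneg fun _ _ => abs_nonneg _
    linarith
  have hcompact : IsCompact (Icc (-R) R ∩ {y : ℝ | ∀ j, η ≤ |y - v j|}) := by
    refine isCompact_Icc.inter_right ?_
    simp only [ofPred_forall]
    exact isClosed_iInter fun j => isClosed_le continuous_const
      (continuous_id.sub continuous_const).abs
  have hin : ∀ᶠ d in 𝓝 c, ∀ y ∈ Icc (-R) R ∩ {y : ℝ | ∀ j, η ≤ |y - v j|},
      0 < evalMonic n c y * evalMonic n d y := by
    refine hcompact.eventually_forall_of_forall_eventually fun y hy => ?_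
    have hc : ContinuousAt (fun z : (Fin n → ℝ) × ℝ => evalMonic n c z.2 * evalMonic n z.1 z.2)
        (c, y) :=
      (((continuous_evalMonic n).comp (continuous_const.prodMk continuous_snd)).mul
        (continuous_evalMonic n)).continuousAt
    refine hc.eventually (lt_mem_nhds ?_)
    refine mul_self_pos.2 fun h0 => ?_
    obtain ⟨j, hj⟩ := hv y h0
    have := hy.2 j
    rw [hj, sub_self, abs_zero] at this
    linarith
  filter_upwards [hsum, hin] with d hd1 hd2 y hy
  by_cases hyR : y ∈ Icc (-R) R
  · exact hd2 y ⟨hyR, hy⟩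
  · have hyR' : R < |y| := by
      rw [mem_Icc, ← abs_le, not_le] at hyR
      exact hyR
    have h1 := pow_mul_evalMonic_pos c (x := y) (by linarith) (by linarith)
    have h2 := pow_mul_evalMonic_pos d (x := y) (by linarith) (by linarith)
    have h3 : 0 < (y ^ n * y ^ n) * (evalMonic n c y * evalMonic n d y) := by
      nlinarith [mul_pos h1 h2]
    exact pos_of_mul_pos_right h3 (mul_self_nonneg _)

theorem units_eq_of_mul_pos {a b : ℤˣ} {x y : ℝ} (h : 0 < x * y)
    (ha : 0 ≤ ((a : ℤˣ) : ℝ) * x) (hb : 0 ≤ ((b : ℤˣ) : ℝ) * y) : a = b := by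
  rcases Int.units_eq_one_or a with rfl | rfl <;> rcases Int.units_eq_one_or b with rfl | rfl <;>
    first
    | rfl
    | (simp only [Units.val_one, Int.cast_one, one_mul, Units.val_neg, Int.cast_neg] at ha hb
       nlinarith)

/-- An ordered configuration representing the real root divisors of a tuple of polynomials. -/
def rootConf {n m : ℕ} (hm : 1 ≤ m) (c : Dspace n m) : OrdConf n m :=
  (exists_rootConf hm c).choose

theorem exists_rootConf_eq {n m : ℕ} (hm : 1 ≤ m) (c : Dspace n m) (i : Fin (m + 1)) (x : ℝ)
    (hx : evalMonic n (c.1 i) x = 0) : ∃ j, (rootConf hm c).1 i j = x :=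
  (exists_rootConf hm c).choose_spec.1 i x hx

theorem occ_rootConf {n m : ℕ} (hm : 1 ≤ m) (c : Dspace n m) (i : Fin (m + 1)) (x : ℝ) :
    occ ((rootConf hm c).1 i) x % 2 = (polyOf n (c.1 i)).rootMultiplicity x % 2 :=
  (exists_rootConf hm c).choose_spec.2.1 i x

theorem rightSign_rootConf_mul_nonneg {n m : ℕ} (hm : 1 ≤ m) (c : Dspace n m) (i : Fin (m + 1))
    (y : ℝ) : 0 ≤ ((rightSign ((rootConf hm c).1 i) y : ℤˣ) : ℝ) * evalMonic n (c.1 i) y :=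
  (exists_rootConf hm c).choose_spec.2.2 i y

theorem eventually_rightSign_rootConf {n m : ℕ} (hm : 1 ≤ m) (c : Dspace n m) {η : ℝ}
    (hη : 0 < η) : ∀ᶠ d in 𝓝 c, ∀ i y, (∀ j, η ≤ |y - (rootConf hm c).1 i j|) →
      0 < evalMonic n (c.1 i) y * evalMonic n (d.1 i) y ∧
      rightSign ((rootConf hm d).1 i) y = rightSign ((rootConf hm c).1 i) y := by
  refine eventually_all.2 fun i => ?_
  have hc : Tendsto (fun d : Dspace n m => d.1 i) (𝓝 c) (𝓝 (c.1 i)) :=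
    ((continuous_apply i).comp continuous_subtype_val).tendsto c
  filter_upwards [hc.eventually (eventually_evalMonic_mul_pos (c.1 i) _
    (exists_rootConf_eq hm c i) hη)] with d hd y hy
  refine ⟨hd y hy, ?_⟩
  have h := hd y hy
  rw [mul_comm] at h
  exact units_eq_of_mul_pos h (rightSign_rootConf_mul_nonneg hm d i y)
    (rightSign_rootConf_mul_nonneg hm c i y)

/-- The map sending a tuple of polynomials to the class of its real root divisors. -/
def rootClass {n m : ℕ} (hm : 1 ≤ m) (c : Dspace n m) : Tspace n m := toT (rootConf hm c)

theorem continuous_rootClass {n m : ℕ} (hn : 1 ≤ n) (hm : 1 ≤ m) :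
    Continuous (rootClass hm : Dspace n m → Tspace n m) := by
  refine continuous_iff_continuousAt.2 fun c => tendsto_nhds.2 fun O hO hc => ?_
  obtain ⟨η, h, hη⟩ :=
    ((eventually_toT_mem hn (rootConf hm c) hO hc).and self_mem_nhdsWithin).exists
  filter_upwards [eventually_rightSign_rootConf hm c hη] with d hd
  exact h _ fun i y hy => (hd i y fun j => (hy j).le).2

/-- An ordered representative of a mod-2 particle configuration. -/
def repT {n m : ℕ} (A : Tspace n m) : OrdConf n m :=
  Function.surjInv (isQuotientMap_toT n m).surjective A

theorem toT_repT {n m : ℕ} (A : Tspace n m) : toT (repT A) = A :=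
  Function.surjInv_eq _ A

theorem parityEquiv_repT {n m : ℕ} (u : OrdConf n m) (i : Fin (m + 1)) :
    ParityEquiv ((repT (toT u)).1 i) (u.1 i) :=
  (toT_eq_toT_iff _ _).1 (toT_repT _) i

/-- The tuple of polynomials obtained from a mod-2 particle configuration by rounding at
scale `e`. -/
def smoothing {n m : ℕ} (A : Tspace n m) (e : ℝ) : Fin (m + 1) → Fin n → ℝ :=
  fun i => roundCoeff ((repT A).1 i) e

theorem smoothing_toT {n m : ℕ} (u : OrdConf n m) (e : ℝ) :
    smoothing (toT u) e = fun i => roundCoeff (u.1 i) e :=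
  funext fun i => roundCoeff_congr (parityEquiv_repT u i) e

theorem continuousAt_smoothing_toT {n m : ℕ} (u : OrdConf n m) {e : ℝ} (he : e ≠ 0) :
    ContinuousAt (fun p : OrdConf n m × ℝ => smoothing (toT p.1) p.2) (u, e) := by
  simp only [smoothing_toT]
  refine continuousAt_pi.2 fun i => ?_
  have h : ContinuousAt (fun p : OrdConf n m × ℝ => (p.1.1 i, p.2)) (u, e) :=
    (((continuous_apply i).comp (continuous_subtype_val.comp continuous_fst)).prodMk
      continuous_snd).continuousAt
  exact (continuousAt_roundCoeff (u.1 i) he).comp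
    (f := fun p : OrdConf n m × ℝ => (p.1.1 i, p.2)) h

theorem continuous_smoothing {n m : ℕ} :
    Continuous fun p : Tspace n m × Ioi (0 : ℝ) => smoothing p.1 p.2 := by
  have : LocallyCompactSpace (Ioi (0 : ℝ)) := isOpen_Ioi.locallyCompactSpace
  refine (isQuotientMap_toT n m).continuous_lift_prod_left ?_
  refine continuous_iff_continuousAt.2 fun p => ?_
  exact (continuousAt_smoothing_toT p.1 (ne_of_gt p.2.2)).comp
    (f := fun q : OrdConf n m × Ioi (0 : ℝ) => (q.1, (q.2 : ℝ)))
    (continuous_fst.prodMk (continuous_subtype_val.comp continuous_snd)).continuousAt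

/-- A truncated measure of how far the polynomials of a smoothing are from vanishing
simultaneously at `x`. -/
def nonvanishing {n m : ℕ} (A : Tspace n m) (x e : ℝ) : ℝ :=
  if e ≤ 0 then 1 else min 1 (∑ i, |evalMonic n (smoothing A e i) x| / e ^ n)

theorem nonvanishing_nonneg {n m : ℕ} (A : Tspace n m) (x e : ℝ) : 0 ≤ nonvanishing A x e := by
  unfold nonvanishing
  split_ifs with h
  · exact zero_le_one
  · exact le_min zero_le_one (Finset.sum_nonneg fun i _ =>
      div_nonneg (abs_nonneg _) (pow_nonneg (not_le.1 h).le _))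

theorem nonvanishing_eq_one {n m : ℕ} (u : OrdConf n m) {x e : ℝ} (he : e ≤ 1)
    (h : ∃ i, ∀ j, 2 * e ≤ |x - u.1 i j|) : nonvanishing (toT u) x e = 1 := by
  unfold nonvanishing
  split_ifs with h0
  · rfl
  rw [not_le] at h0
  obtain ⟨i, hi⟩ := h
  refine min_eq_left ?_
  refine le_trans ?_ (Finset.single_le_sum (f := fun i =>
    |evalMonic n (smoothing (toT u) e i) x| / e ^ n)
    (fun i _ => div_nonneg (abs_nonneg _) (pow_nonneg h0.le _)) (Finset.mem_univ i))
  rw [one_le_div (pow_pos h0 n), smoothing_toT]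
  refine (pow_le_rightSign_mul_evalMonic (u.1 i) h0 he hi).trans ((le_abs_self _).trans ?_)
  rw [abs_mul]
  rcases Int.units_eq_one_or (rightSign (u.1 i) x) with h | h <;> simp [h]

theorem continuous_nonvanishing_toT {n m : ℕ} :
    Continuous fun p : OrdConf n m × ℝ × ℝ => nonvanishing (toT p.1) p.2.1 p.2.2 := by
  refine continuous_iff_continuousAt.2 fun ⟨u, x, e⟩ => ?_
  rcases lt_or_ge 0 e with he | he
  · have hev : (fun p : OrdConf n m × ℝ × ℝ => nonvanishing (toT p.1) p.2.1 p.2.2) =ᶠ[𝓝 (u, x, e)]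
        fun p => min 1 (∑ i, |evalMonic n (smoothing (toT p.1) p.2.2 i) p.2.1| / p.2.2 ^ n) := by
      have : ∀ᶠ p : OrdConf n m × ℝ × ℝ in 𝓝 (u, x, e), 0 < p.2.2 :=
        (continuous_snd.comp continuous_snd).continuousAt.eventually (lt_mem_nhds he)
      filter_upwards [this] with p hp
      exact if_neg (not_le.2 hp)
    refine ContinuousAt.congr ?_ hev.symm
    refine continuousAt_const.min (tendsto_finsetSum _ fun i _ => ?_)
    refine ContinuousAt.div (ContinuousAt.abs ?_) (by fun_prop) (pow_ne_zero n he.ne')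
    have h1 : ContinuousAt (fun p : OrdConf n m × ℝ × ℝ => smoothing (toT p.1) p.2.2)
        (u, x, e) :=
      ContinuousAt.comp (x := (u, x, e)) (f := fun q : OrdConf n m × ℝ × ℝ => (q.1, q.2.2))
        (g := fun p : OrdConf n m × ℝ => smoothing (toT p.1) p.2)
        (continuousAt_smoothing_toT u he.ne') (by fun_prop)
    have h2 : ContinuousAt (fun p : OrdConf n m × ℝ × ℝ =>
        (smoothing (toT p.1) p.2.2 i, p.2.1)) (u, x, e) :=
      (((continuous_apply i).continuousAt).comp h1).prodMk (by fun_prop)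
    exact (continuous_evalMonic n).continuousAt.comp h2
  · refine (continuousAt_const (y := (1 : ℝ))).congr ?_
    obtain ⟨δ, hδ, h0⟩ := ((eventually_exists_le_abs_sub u.2).and self_mem_nhdsWithin).exists
    replace h0 : 0 < δ := h0
    have h1 : ∀ᶠ p : OrdConf n m × ℝ × ℝ in 𝓝 (u, x, e), ∀ i j, |p.1.1 i j - u.1 i j| < δ / 2 :=
      (show ContinuousAt (fun p : OrdConf n m × ℝ × ℝ => p.1.1) (u, x, e) by fun_prop).eventually
        (eventually_forall_abs_sub_lt u.1 (half_pos h0))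
    have h2 : ∀ᶠ p : OrdConf n m × ℝ × ℝ in 𝓝 (u, x, e), p.2.2 < min 1 (δ / 4) :=
      (continuous_snd.comp continuous_snd).continuousAt.eventually
        (gt_mem_nhds (lt_of_le_of_lt he (by positivity)))
    filter_upwards [h1, h2] with p hp1 hp2
    rw [lt_min_iff] at hp2
    refine (nonvanishing_eq_one p.1 hp2.1.le ?_).symm
    obtain ⟨i, hi⟩ := hδ p.2.1
    refine ⟨i, fun j => ?_⟩
    have h3 := hp1 i j
    have h4 := hi j
    have h5 := abs_sub_le p.2.1 (p.1.1 i j) (u.1 i j)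
    linarith [hp2.2]

/-- A scale below which the smoothing of a configuration has no common real root. -/
def scaleBound {n m : ℕ} (A : Tspace n m) : ℝ :=
  sInf ((fun q : ℝ × ℝ => q.2 + nonvanishing A q.1 q.2) '' (univ ×ˢ Icc 0 1))

theorem bddBelow_scale {n m : ℕ} (A : Tspace n m) (s : Set ℝ) :
    BddBelow ((fun q : ℝ × ℝ => q.2 + nonvanishing A q.1 q.2) '' (s ×ˢ Icc 0 1)) := by
  refine ⟨0, ?_⟩
  rintro _ ⟨q, hq, rfl⟩
  exact add_nonneg hq.2.1 (nonvanishing_nonneg _ _ _)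

theorem nonvanishing_zero {n m : ℕ} (A : Tspace n m) (x : ℝ) : nonvanishing A x 0 = 1 :=
  if_pos le_rfl

theorem scaleBound_le_one {n m : ℕ} (A : Tspace n m) : scaleBound A ≤ 1 :=
  csInf_le (bddBelow_scale A univ) ⟨(0, 0), ⟨mem_univ _, left_mem_Icc.2 zero_le_one⟩,
    by simp [nonvanishing_zero]⟩

theorem smoothing_mem {n m : ℕ} (A : Tspace n m) {e : ℝ} (he : 0 < e) (h : e < scaleBound A) :
    smoothing A e ∈ Dspace n m := by
  intro x
  have h1 : scaleBound A ≤ e + nonvanishing A x e :=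
    csInf_le (bddBelow_scale A univ)
      ⟨(x, e), ⟨mem_univ _, he.le, h.le.trans (scaleBound_le_one A)⟩, rfl⟩
  by_contra! h0
  have : nonvanishing A x e = 0 := by
    simp [nonvanishing, he.not_ge, h0]
  linarith

theorem scaleBound_toT_eq {n m : ℕ} (u : OrdConf n m) {R : ℝ} (hR : 2 ≤ R)
    (hu : ∀ i j, |u.1 i j| ≤ R - 2) :
    scaleBound (toT u) =
      sInf ((fun q : ℝ × ℝ => q.2 + nonvanishing (toT u) q.1 q.2) '' (Icc (-R) R ×ˢ Icc 0 1)) := by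
  have h0 : (1 : ℝ) ∈ (fun q : ℝ × ℝ => q.2 + nonvanishing (toT u) q.1 q.2) ''
      (Icc (-R) R ×ˢ Icc 0 1) :=
    ⟨(0, 0), ⟨⟨by linarith, by linarith⟩, left_mem_Icc.2 zero_le_one⟩,
      by simp [nonvanishing_zero]⟩
  refine le_antisymm (csInf_le_csInf (bddBelow_scale _ _) ⟨1, h0⟩
    (image_mono (prod_mono_left (subset_univ _)))) ?_
  refine le_csInf ⟨1, image_mono (prod_mono_left (subset_univ _)) h0⟩ ?_
  rintro _ ⟨q, hq, rfl⟩
  by_cases hx : q.1 ∈ Icc (-R) R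
  · exact csInf_le (bddBelow_scale _ _) ⟨q, ⟨hx, hq.2⟩, rfl⟩
  · refine (csInf_le (bddBelow_scale _ _) h0).trans ?_
    have h1 : nonvanishing (toT u) q.1 q.2 = 1 := by
      refine nonvanishing_eq_one u hq.2.2 ⟨0, fun j => ?_⟩
      rw [mem_Icc, ← abs_le, not_le] at hx
      have := hu 0 j
      have := abs_sub_abs_le_abs_sub q.1 (u.1 0 j)
      linarith [hq.2.2]
    change 1 ≤ q.2 + nonvanishing (toT u) q.1 q.2
    rw [h1]
    linarith [hq.2.1]

theorem exists_abs_add_two_le {n m : ℕ} (u : Fin (m + 1) → Fin n → ℝ) :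
    ∃ R, 2 ≤ R ∧ ∀ i j, |u i j| < R - 2 := by
  obtain ⟨M, hM⟩ := (finite_range fun a : Fin (m + 1) × Fin n => |u a.1 a.2|).bddAbove
  refine ⟨max 0 M + 3, by linarith [le_max_left 0 M], fun i j => ?_⟩
  have := hM ⟨(i, j), rfl⟩
  simp only at this
  linarith [le_max_right 0 M]

theorem scaleBound_pos {n m : ℕ} (A : Tspace n m) : 0 < scaleBound A := by
  obtain ⟨u, rfl⟩ := (isQuotientMap_toT n m).surjective A
  obtain ⟨R, hR, hu⟩ := exists_abs_add_two_le u.1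
  rw [scaleBound_toT_eq u hR fun i j => (hu i j).le]
  have hc : Continuous fun q : ℝ × ℝ => q.2 + nonvanishing (toT u) q.1 q.2 :=
    continuous_snd.add (continuous_nonvanishing_toT.comp (continuous_const.prodMk continuous_id))
  obtain ⟨q, hq, h⟩ := ((isCompact_Icc (a := -R) (b := R)).prod
    (isCompact_Icc (a := (0 : ℝ)) (b := 1))).exists_sInf_image_eq
      ⟨(0, 0), ⟨by linarith, by linarith⟩, left_mem_Icc.2 zero_le_one⟩ hc.continuousOn
  rw [h]
  rcases hq.2.1.eq_or_lt with h0 | h0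
  · rw [← h0, nonvanishing_zero]
    norm_num
  · exact add_pos_of_pos_of_nonneg h0 (nonvanishing_nonneg _ _ _)

theorem continuous_scaleBound {n m : ℕ} :
    Continuous (scaleBound : Tspace n m → ℝ) := by
  refine (isQuotientMap_toT n m).continuous_iff.2 (continuous_iff_continuousAt.2 fun u => ?_)
  obtain ⟨R, hR, hu⟩ := exists_abs_add_two_le u.1
  have hev : ∀ᶠ v : OrdConf n m in 𝓝 u, ∀ i j, |v.1 i j| < R - 2 := by
    simp only [eventually_all]
    intro i j
    exact (((continuous_apply_apply i j).comp
      continuous_subtype_val).abs.continuousAt).eventually (gt_mem_nhds (hu i j))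
  have hc : Continuous fun v : OrdConf n m =>
      sInf ((fun q : ℝ × ℝ => q.2 + nonvanishing (toT v) q.1 q.2) '' (Icc (-R) R ×ˢ Icc 0 1)) :=
    (isCompact_Icc.prod isCompact_Icc).continuous_sInf
      ((continuous_snd.comp continuous_snd).add continuous_nonvanishing_toT)
  refine hc.continuousAt.congr ?_
  filter_upwards [hev] with v hv
  exact (scaleBound_toT_eq v hR fun i j => (hv i j).le).symm

theorem continuous_smoothing_comp {n m : ℕ} {X : Type*} [TopologicalSpace X] {a : X → Tspace n m}
    {e : X → ℝ} (ha : Continuous a) (he : Continuous e) (h : ∀ x, 0 < e x) :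
    Continuous fun x => smoothing (a x) (e x) :=
  Continuous.comp (g := fun p : Tspace n m × Ioi (0 : ℝ) => smoothing p.1 p.2)
    (f := fun x => (a x, (⟨e x, h x⟩ : Ioi (0 : ℝ)))) continuous_smoothing
    (ha.prodMk (he.subtype_mk h))

theorem smoothing_scale_mem {n m : ℕ} (A : Tspace n m) {t : ℝ} (h0 : 0 < t) (h1 : t ≤ 1) :
    smoothing A (t * (scaleBound A / 2)) ∈ Dspace n m := by
  have h := scaleBound_pos A
  refine smoothing_mem A (by positivity) ?_
  nlinarith

theorem exists_forall_rootClass_smoothing_mem {n m : ℕ} (hn : 1 ≤ n) (hm : 1 ≤ m) (u : OrdConf n m)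
    {O : Set (Tspace n m)} (hO : IsOpen O) (hu : toT u ∈ O) :
    ∃ δ > 0, ∀ v : OrdConf n m, (∀ i j, |v.1 i j - u.1 i j| < δ) → ∀ e, 0 < e → e ≤ δ →
      ∀ h : smoothing (toT v) e ∈ Dspace n m, rootClass hm ⟨_, h⟩ ∈ O := by
  obtain ⟨η, h, hη⟩ := ((eventually_toT_mem hn u hO hu).and self_mem_nhdsWithin).exists
  replace hη : 0 < η := hη
  refine ⟨min 1 (η / 4), by positivity, fun v hv e he hle hmem => h _ fun i y hy => ?_⟩
  rw [le_min_iff] at hle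
  have hsep : ∀ j, 3 * η / 4 ≤ |y - v.1 i j| := fun j => by
    have h1 := (hv i j).trans_le (min_le_right _ _)
    have h2 := abs_sub_le y (v.1 i j) (u.1 i j)
    linarith [hy j]
  have h1 := pow_le_rightSign_mul_evalMonic (v.1 i) he hle.1 (x := y)
    fun j => by linarith [hsep j, hle.2]
  have h2 := rightSign_rootConf_mul_nonneg hm ⟨_, hmem⟩ i y
  have h3 : roundCoeff (v.1 i) e = smoothing (toT v) e i := by rw [smoothing_toT]
  rw [h3] at h1
  have h4 : 0 < ((rightSign (v.1 i) y : ℤˣ) : ℝ) * evalMonic n (smoothing (toT v) e i) y :=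
    (pow_pos he n).trans_le h1
  have h5 : evalMonic n (smoothing (toT v) e i) y ≠ 0 := fun h0 => by
    rw [h0, mul_zero] at h4
    exact lt_irrefl _ h4
  rw [units_eq_of_mul_pos (mul_self_pos.2 h5) h2 h4.le]
  refine rightSign_congr fun j => ?_
  have h6 := abs_lt.1 ((hv i j).trans_le (min_le_right _ _))
  have h7 := hy j
  rcases le_total y (u.1 i j) with h8 | h8
  · rw [abs_of_nonpos (by linarith)] at h7
    exact ⟨fun _ => by linarith, fun _ => by linarith⟩
  · rw [abs_of_nonneg (by linarith)] at h7
    exact ⟨fun _ => by linarith, fun _ => by linarith⟩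

/-- The homotopy from the identity of `Tspace` to the root class of the smoothing. -/
def smoothingTrack {n m : ℕ} (hm : 1 ≤ m) (p : Tspace n m × unitInterval) : Tspace n m :=
  if h : 0 < (p.2 : ℝ) then
    rootClass hm ⟨smoothing p.1 (p.2 * (scaleBound p.1 / 2)), smoothing_scale_mem p.1 h p.2.2.2⟩
  else p.1

theorem smoothingTrack_of_pos {n m : ℕ} (hm : 1 ≤ m) (A : Tspace n m) {t : unitInterval}
    (h : 0 < (t : ℝ)) : smoothingTrack hm (A, t) =
      rootClass hm ⟨smoothing A (t * (scaleBound A / 2)), smoothing_scale_mem A h t.2.2⟩ :=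
  dif_pos h

theorem continuous_smoothingTrack {n m : ℕ} (hn : 1 ≤ n) (hm : 1 ≤ m) :
    Continuous (smoothingTrack hm : Tspace n m × unitInterval → Tspace n m) := by
  have hT : Continuous (toT : OrdConf n m → Tspace n m) := (isQuotientMap_toT n m).continuous
  have hopen : IsOpen {p : Tspace n m × unitInterval | 0 < (p.2 : ℝ)} :=
    isOpen_lt continuous_const (by fun_prop)
  have hpos : ContinuousOn (smoothingTrack hm) {p : Tspace n m × unitInterval | 0 < (p.2 : ℝ)} := by
    rw [continuousOn_iff_continuous_domRestrict]
    have hf : Continuous fun p : {p : Tspace n m × unitInterval | 0 < (p.2 : ℝ)} => p.1.1 :=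
      continuous_fst.comp continuous_subtype_val
    have hs : Continuous fun p : {p : Tspace n m × unitInterval | 0 < (p.2 : ℝ)} =>
        smoothing p.1.1 (p.1.2 * (scaleBound p.1.1 / 2)) := by
      refine continuous_smoothing_comp hf ?_ fun p => mul_pos p.2 (half_pos (scaleBound_pos _))
      exact (continuous_subtype_val.comp (continuous_snd.comp continuous_subtype_val)).mul
        ((continuous_scaleBound.comp hf).div_const 2)
    refine ((continuous_rootClass hn hm).comp (hs.subtype_mk fun p =>
      smoothing_scale_mem p.1.1 p.2 p.1.2.2.2)).congr fun p => ?_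
    exact (smoothingTrack_of_pos hm p.1.1 p.2).symm
  refine (isQuotientMap_toT n m).continuous_lift_prod_left ?_
  refine continuous_iff_continuousAt.2 fun ⟨u, t⟩ => ?_
  by_cases ht : 0 < (t : ℝ)
  · exact (hpos.continuousAt (hopen.mem_nhds ht)).comp (x := (u, t))
      (f := fun p : OrdConf n m × unitInterval => (toT p.1, p.2))
      (hT.prodMap continuous_id).continuousAt
  · have ht0 : (t : ℝ) = 0 := le_antisymm (not_lt.1 ht) t.2.1
    refine tendsto_nhds.2 fun O hO hmem => ?_
    replace hmem : toT u ∈ O := by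
      have : smoothingTrack hm (toT u, t) = toT u := dif_neg ht
      change smoothingTrack hm (toT u, t) ∈ O at hmem
      rwa [this] at hmem
    obtain ⟨δ, hδ, h⟩ := exists_forall_rootClass_smoothing_mem hn hm u hO hmem
    have h1 : ∀ᶠ p : OrdConf n m × unitInterval in 𝓝 (u, t), ∀ i j, |p.1.1 i j - u.1 i j| < δ :=
      (show ContinuousAt (fun p : OrdConf n m × unitInterval => p.1.1) (u, t) by
        fun_prop).eventually (eventually_forall_abs_sub_lt u.1 hδ)
    have h2 : ∀ᶠ p : OrdConf n m × unitInterval in 𝓝 (u, t), (p.2 : ℝ) < δ :=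
      (continuous_subtype_val.comp continuous_snd).continuousAt.eventually
        (gt_mem_nhds (by simpa [ht0] using hδ))
    have h3 : ∀ᶠ p : OrdConf n m × unitInterval in 𝓝 (u, t), toT p.1 ∈ O :=
      (hT.comp continuous_fst).continuousAt.eventually (hO.mem_nhds hmem)
    filter_upwards [h1, h2, h3] with p hp1 hp2 hp3
    change smoothingTrack hm (toT p.1, p.2) ∈ O
    unfold smoothingTrack
    split_ifs with hp
    · refine h p.1 hp1 _ (mul_pos hp (half_pos (scaleBound_pos _))) ?_ _
      have := scaleBound_le_one (toT p.1)
      have := scaleBound_pos (toT p.1)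
      dsimp only at hp ⊢
      nlinarith
    · exact hp3

theorem evalMonic_convexComb {n : ℕ} (c d : Fin n → ℝ) (s x : ℝ) :
    evalMonic n ((1 - s) • c + s • d) x = (1 - s) * evalMonic n c x + s * evalMonic n d x := by
  simp only [evalMonic, mul_add, Finset.mul_sum, Pi.add_apply, Pi.smul_apply, smul_eq_mul]
  rw [add_add_add_comm, ← Finset.sum_add_distrib, ← add_mul]
  congr 1
  · ring
  · exact Finset.sum_congr rfl fun j _ => by ring

theorem eventually_segment_mem {n m : ℕ} (hn : 1 ≤ n) (hm : 1 ≤ m) (c : Dspace n m) :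
    ∃ l : ℝ, ∀ᶠ d in 𝓝 c, 0 < l ∧ ∀ e, 0 < e → e ≤ l → ∀ s ∈ Icc (0 : ℝ) 1,
      (1 - s) • d.1 + s • smoothing (rootClass hm d) e ∈ Dspace n m := by
  obtain ⟨δ, hδ, h0⟩ :=
    ((eventually_exists_le_abs_sub (rootConf hm c).2).and self_mem_nhdsWithin).exists
  replace h0 : 0 < δ := h0
  have hη : 0 < δ / 4 := by positivity
  refine ⟨min 1 (δ / 4), ?_⟩
  filter_upwards [eventually_rightSign_rootConf hm c hη] with d hd
  refine ⟨by positivity, fun e he hle s hs x => ?_⟩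
  rw [le_min_iff] at hle
  obtain ⟨i, hi⟩ := hδ x
  obtain ⟨w, hw, hnear⟩ := exists_parityEquiv_near hn hη.le
    fun y hy => (hd i y fun j => (hy j).le).2
  refine ⟨i, ?_⟩
  have h1 := pow_le_rightSign_mul_evalMonic w he hle.1 (x := x) fun j => by
    obtain ⟨k, hk⟩ := hnear j
    have h2 := abs_sub_le x (w j) ((rootConf hm c).1 i k)
    linarith [hi k, hle.2]
  have h2 : roundCoeff w e = smoothing (rootClass hm d) e i := by
    rw [rootClass, smoothing_toT]
    exact roundCoeff_congr hw e
  have h3 := rightSign_rootConf_mul_nonneg hm d i x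
  have h4 : evalMonic n (d.1 i) x ≠ 0 := by
    have h5 := (hd i x fun j => by linarith [hi j]).1
    exact right_ne_zero_of_mul h5.ne'
  rw [h2, hw.rightSign_eq] at h1
  have h5 : 0 < ((rightSign ((rootConf hm d).1 i) x : ℤˣ) : ℝ) * evalMonic n (d.1 i) x :=
    lt_of_le_of_ne h3 (mul_ne_zero (by simp) h4).symm
  have h6 := (pow_pos he n).trans_le h1
  rw [Pi.add_apply, Pi.smul_apply, Pi.smul_apply, evalMonic_convexComb]
  intro h7
  have h8 := congrArg (((rightSign ((rootConf hm d).1 i) x : ℤˣ) : ℝ) * ·) h7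
  simp only [mul_zero] at h8
  rcases hs.1.eq_or_lt with rfl | hs0
  · nlinarith
  · nlinarith [mul_pos hs0 h6, mul_nonneg (sub_nonneg.2 hs.2) h5.le]

theorem exists_continuous_segment_mem {n m : ℕ} (hn : 1 ≤ n) (hm : 1 ≤ m) :
    ∃ l : C(Dspace n m, ℝ), ∀ d, 0 < l d ∧ l d ≤ scaleBound (rootClass hm d) / 2 ∧
      ∀ s ∈ Icc (0 : ℝ) 1, (1 - s) • d.1 + s • smoothing (rootClass hm d) (l d) ∈ Dspace n m := by
  obtain ⟨g, hg⟩ := exists_continuous_forall_mem_convex_of_local_const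
    (t := fun d : Dspace n m => {l : ℝ | 0 < l ∧ ∀ e, 0 < e → e ≤ l → ∀ s ∈ Icc (0 : ℝ) 1,
      (1 - s) • d.1 + s • smoothing (rootClass hm d) e ∈ Dspace n m})
    (fun d => OrdConnected.convex ⟨fun a ha b hb l hl =>
      ⟨ha.1.trans_le hl.1, fun e he hle => hb.2 e he (hle.trans hl.2)⟩⟩)
    (eventually_segment_mem hn hm)
  have hpos : ∀ d, 0 < min (g d) (scaleBound (rootClass hm d) / 2) := fun d =>
    lt_min (hg d).1 (half_pos (scaleBound_pos _))
  refine ⟨⟨fun d => min (g d) (scaleBound (rootClass hm d) / 2), g.continuous.min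
    ((continuous_scaleBound.comp (continuous_rootClass hn hm)).div_const 2)⟩, fun d =>
    ⟨hpos d, min_le_right _ _, (hg d).2 _ (hpos d) (min_le_left _ _)⟩⟩

/-- A homotopy inverse of the root class map. -/
def resolve {n m : ℕ} : C(Tspace n m, Dspace n m) where
  toFun A := ⟨smoothing A (scaleBound A / 2),
    smoothing_mem A (half_pos (scaleBound_pos A)) (half_lt_self (scaleBound_pos A))⟩
  continuous_toFun := (continuous_smoothing_comp continuous_id
    (continuous_scaleBound.div_const 2) fun A => half_pos (scaleBound_pos A)).subtype_mk _

theorem rootClass_comp_resolve_homotopic {n m : ℕ} (hn : 1 ≤ n) (hm : 1 ≤ m) :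
    ((⟨rootClass hm, continuous_rootClass hn hm⟩ : C(Dspace n m, Tspace n m)).comp
      resolve).Homotopic (ContinuousMap.id _) := by
  refine ContinuousMap.Homotopic.symm ⟨⟨⟨fun p => smoothingTrack hm (p.2, p.1),
    (continuous_smoothingTrack hn hm).comp continuous_swap⟩, fun A => ?_, fun A => ?_⟩⟩
  · simp [smoothingTrack]
  · simp [smoothingTrack, resolve]

theorem resolve_comp_rootClass_homotopic {n m : ℕ} (hn : 1 ≤ n) (hm : 1 ≤ m) :
    (resolve.comp (⟨rootClass hm, continuous_rootClass hn hm⟩ :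
      C(Dspace n m, Tspace n m))).Homotopic (ContinuousMap.id _) := by
  obtain ⟨l, hl⟩ := exists_continuous_segment_mem (n := n) hn hm
  have hf := continuous_rootClass (n := n) hn hm
  have hE : Continuous fun d : Dspace n m => scaleBound (rootClass hm d) / 2 :=
    (continuous_scaleBound.comp hf).div_const 2
  have hmem : ∀ (d : Dspace n m) {e : ℝ}, 0 < e → e ≤ scaleBound (rootClass hm d) / 2 →
      smoothing (rootClass hm d) e ∈ Dspace n m := fun d e he hle =>
    smoothing_mem _ he (hle.trans_lt (half_lt_self (scaleBound_pos _)))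
  let mid : C(Dspace n m, Dspace n m) :=
    ⟨fun d => ⟨smoothing (rootClass hm d) (l d), hmem d (hl d).1 (hl d).2.1⟩,
      (continuous_smoothing_comp hf l.continuous fun d => (hl d).1).subtype_mk _⟩
  have h1 : (ContinuousMap.id (Dspace n m)).Homotopic mid := by
    refine ⟨⟨⟨fun p => ⟨(1 - (p.1 : ℝ)) • p.2.1 + (p.1 : ℝ) • smoothing (rootClass hm p.2) (l p.2),
      (hl p.2).2.2 _ p.1.2⟩, Continuous.subtype_mk ?_ _⟩, fun d => ?_, fun d => ?_⟩⟩
    · have h2 : Continuous fun p : unitInterval × Dspace n m =>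
          smoothing (rootClass hm p.2) (l p.2) :=
        (continuous_smoothing_comp hf l.continuous fun d => (hl d).1).comp continuous_snd
      fun_prop
    · exact Subtype.ext (by simp)
    · exact Subtype.ext (by simp [mid])
  have hseg : ∀ p : unitInterval × Dspace n m,
      0 < (1 - (p.1 : ℝ)) * l p.2 + p.1 * (scaleBound (rootClass hm p.2) / 2) ∧
      (1 - (p.1 : ℝ)) * l p.2 + p.1 * (scaleBound (rootClass hm p.2) / 2) ≤
        scaleBound (rootClass hm p.2) / 2 := fun p => by
    have h2 := p.1.2.1
    have h3 := p.1.2.2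
    obtain ⟨h4, h5, -⟩ := hl p.2
    constructor <;> nlinarith
  have h2 : mid.Homotopic (resolve.comp (⟨rootClass hm, hf⟩ : C(Dspace n m, Tspace n m))) := by
    refine ⟨⟨⟨fun p => ⟨smoothing (rootClass hm p.2)
      ((1 - (p.1 : ℝ)) * l p.2 + p.1 * (scaleBound (rootClass hm p.2) / 2)),
      hmem p.2 (hseg p).1 (hseg p).2⟩, Continuous.subtype_mk ?_ _⟩, fun d => ?_, fun d => ?_⟩⟩
    · refine continuous_smoothing_comp (hf.comp continuous_snd) ?_ fun p => (hseg p).1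
      have h3 := hE.comp (continuous_snd (X := unitInterval) (Y := Dspace n m))
      have h4 : Continuous fun p : unitInterval × Dspace n m => (p.1 : ℝ) := by fun_prop
      exact ((continuous_const.sub h4).mul (l.continuous.comp continuous_snd)).add (h4.mul h3)
    · exact Subtype.ext (by simp [mid])
    · exact Subtype.ext (by simp [resolve])
  exact (h1.trans h2).symm

end

/-- For all `n ≥ 1`, `m ≥ 1`, the map `D(n,m) → T(n,m)` sending a tuple of polynomials to
the class of the tuple of their real root divisors (real roots with multiplicities, the
multiplicities then reduced mod 2) is continuous and a homotopy equivalence. -/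
theorem dspace_homotopyEquiv_tspace (n m : ℕ) (hn : 1 ≤ n) (hm : 1 ≤ m) :
    ∃ h : ContinuousMap.HomotopyEquiv ↥(Dspace n m) (Tspace n m),
      ∀ c : ↥(Dspace n m), ∃ ζ : ↥(Sspace n m),
        h.toFun c = Quotient.mk (Tsetoid n m) ζ ∧
        ∀ (i : Fin (m + 1)) (x : ℝ),
          multOf (ζ.1 i) x % 2 = (polyOf n (c.1 i)).rootMultiplicity x % 2 := by
  exact ⟨⟨⟨rootClass hm, continuous_rootClass hn hm⟩, resolve,
    resolve_comp_rootClass_homotopic hn hm,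
    rootClass_comp_resolve_homotopic hn hm⟩, fun c => ⟨toS (rootConf hm c), rfl, fun i x =>
    (congrArg (· % 2) (multOf_symMk _ x)).trans (occ_rootConf hm c i x)⟩⟩

end
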